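/- arXiv:1501.04039 — 4 statements merged into one kernel-verified Lean document; each statement's English description precedes it below -/
import Mathlib

section
/- Let 𝒜 be a supersolvable line arrangement in ℙ² over an arbitrary field with a modular point P, and let Q ∈ Sing(𝒜) be a singular point that is not modular. Then m(P,𝒜) > m(Q,𝒜). -/
open scoped Classical

/-- A point of the projective plane over `K`. -/
abbrev Pt (K : Type*) [Field K] := Projectivization K (Fin 3 → K)

/-- A (candidate) line arrangement: a finite set of linear subspaces of `K³`. -/
abbrev Arr (K : Type*) [Field K] := Finset (Submodule K (Fin 3 → K))

/-- Every member of `A` is a projective line, i.e. a 2-dimensional linear subspace of `K³`. -/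
def IsLineArr {K : Type*} [Field K] (A : Arr K) : Prop :=
  ∀ L ∈ A, Module.finrank K L = 2

/-- The multiplicity `m(P, A)`: the number of lines of `A` passing through `P`. -/
noncomputable def multAt {K : Type*} [Field K] (A : Arr K) (P : Pt K) : ℕ :=
  (A.filter fun L => P.submodule ≤ L).card

/-- `Sing(A)`: the set of points lying on at least two lines of `A`. -/
def SingSet {K : Type*} [Field K] (A : Arr K) : Set (Pt K) :=
  {P | 2 ≤ multAt A P}

/-- `Sing₂(A)`: the set of simple points, i.e. singular points of multiplicity exactly 2. -/
def Sing2Set {K : Type*} [Field K] (A : Arr K) : Set (Pt K) :=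
  {P | multAt A P = 2}

/-- `m(A)`: the maximum multiplicity of a singular point of `A`. -/
noncomputable def maxMult {K : Type*} [Field K] (A : Arr K) : ℕ :=
  sSup (multAt A '' SingSet A)

/-- `P` is a modular point of `A`: it is singular, and for every other singular point `Q`
the line through `P` and `Q` belongs to `A`. -/
def IsModular {K : Type*} [Field K] (A : Arr K) (P : Pt K) : Prop :=
  P ∈ SingSet A ∧ ∀ Q ∈ SingSet A, Q ≠ P → (P.submodule ⊔ Q.submodule) ∈ A

/-- `A` is supersolvable: it has a modular point. -/
def Supersolvable {K : Type*} [Field K] (A : Arr K) : Prop :=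
  ∃ P, IsModular A P

/-- `A` has full rank (rank 3): its lines have no common point. -/
def FullRank {K : Type*} [Field K] (A : Arr K) : Prop :=
  (⨅ L ∈ A, L) = ⊥

section Lines

variable {K : Type*} [Field K]

theorem Projectivization.sup_submodule_eq_of_le {P R : Pt K} (hPR : P ≠ R)
    {L : Submodule K (Fin 3 → K)} (hL : Module.finrank K L = 2)
    (hP : P.submodule ≤ L) (hR : R.submodule ≤ L) : P.submodule ⊔ R.submodule = L := by
  refine Submodule.eq_of_le_of_finrank_le (sup_le hP hR) ?_
  have hlt : P.submodule < P.submodule ⊔ R.submodule := by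
    refine lt_of_le_of_ne le_sup_left fun h => hPR ?_
    have hRP : R.submodule ≤ P.submodule := h ▸ le_sup_right
    refine Projectivization.submodule_injective
      (Submodule.eq_of_le_of_finrank_eq hRP ?_).symm
    rw [P.finrank_submodule, R.finrank_submodule]
  have := Submodule.finrank_lt_finrank_of_lt hlt
  rw [P.finrank_submodule] at this
  omega

theorem Projectivization.inf_submodule_eq_bot {P : Pt K} {L : Submodule K (Fin 3 → K)}
    (hP : ¬ P.submodule ≤ L) : P.submodule ⊓ L = ⊥ := by
  have hlt : P.submodule ⊓ L < P.submodule :=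
    lt_of_le_of_ne inf_le_left fun h => hP (inf_eq_left.mp h)
  have := Submodule.finrank_lt_finrank_of_lt hlt
  rw [P.finrank_submodule] at this
  exact Submodule.finrank_eq_zero.mp (by omega)

theorem sup_eq_top_of_finrank_eq_two {L N : Submodule K (Fin 3 → K)}
    (hL : Module.finrank K L = 2) (hN : ¬ N ≤ L) : N ⊔ L = ⊤ := by
  have hlt : L < N ⊔ L := lt_of_le_of_ne le_sup_right fun h => hN (h ▸ le_sup_left)
  have h₁ := Submodule.finrank_lt_finrank_of_lt hlt
  have h₂ := Submodule.finrank_le (N ⊔ L)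
  have h₃ : Module.finrank K (Fin 3 → K) = 3 := by simp
  exact Submodule.eq_top_of_finrank_eq (by omega)

theorem exists_submodule_eq_inf {M L : Submodule K (Fin 3 → K)}
    (hM : Module.finrank K M = 2) (hL : Module.finrank K L = 2) (h : ¬ M ≤ L) :
    ∃ X : Pt K, X.submodule = M ⊓ L := by
  have h₁ := Submodule.finrank_sup_add_finrank_inf_eq M L
  have h₃ : Module.finrank K (Fin 3 → K) = 3 := by simp
  rw [sup_eq_top_of_finrank_eq_two hL h, finrank_top, h₃, hM, hL] at h₁
  exact ⟨Projectivization.mk'' (M ⊓ L) (by omega), Projectivization.submodule_mk'' _ _⟩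

theorem mem_singSet_of_mem {A : Arr K} {X : Pt K} {M L : Submodule K (Fin 3 → K)}
    (hM : M ∈ A) (hL : L ∈ A) (hne : M ≠ L) (hXM : X.submodule ≤ M) (hXL : X.submodule ≤ L) :
    X ∈ SingSet A :=
  Finset.one_lt_card.mpr
    ⟨M, Finset.mem_filter.mpr ⟨hM, hXM⟩, L, Finset.mem_filter.mpr ⟨hL, hXL⟩, hne⟩

theorem exists_line_not_through {A : Arr K} (hA : IsLineArr A) {P R : Pt K} (hPR : P ≠ R)
    (hR : R ∈ SingSet A) : ∃ L ∈ A, R.submodule ≤ L ∧ ¬ P.submodule ≤ L := by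
  by_contra! h
  obtain ⟨M, hM, N, hN, hne⟩ := Finset.one_lt_card.mp (show 1 < multAt A R from hR)
  rw [Finset.mem_filter] at hM hN
  have eq_line {M} (hM : M ∈ A ∧ R.submodule ≤ M) : P.submodule ⊔ R.submodule = M :=
    Projectivization.sup_submodule_eq_of_le hPR (hA M hM.1) (h M hM.1 hM.2) hM.2
  exact hne ((eq_line hM).symm.trans (eq_line hN))

end Lines

/-- In a supersolvable line arrangement with modular point `P`, every
non-modular singular point `Q` satisfies `m(P, A) > m(Q, A)`. -/
theorem modular_mult_gt_nonmodular {K : Type*} [Field K] (A : Arr K) (hA : IsLineArr A)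
    (P Q : Pt K) (hP : IsModular A P) (hQ : Q ∈ SingSet A) (hQnm : ¬ IsModular A Q) :
    multAt A Q < multAt A P := by
  have hQP : Q ≠ P := fun h => hQnm (h ▸ hP)
  obtain ⟨R, hR, hRQ, hQR⟩ :
      ∃ R ∈ SingSet A, R ≠ Q ∧ Q.submodule ⊔ R.submodule ∉ A := by
    by_contra! h
    exact hQnm ⟨hQ, h⟩
  have hRP : R ≠ P := by
    rintro rfl
    exact hQR (sup_comm R.submodule Q.submodule ▸ hP.2 Q hQ hQP)
  have hPR := hP.2 R hR hRP
  obtain ⟨L, hL, hRL, hPL⟩ := exists_line_not_through hA hRP.symm hR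
  have hQL : ¬ Q.submodule ≤ L := fun h =>
    hQR (Projectivization.sup_submodule_eq_of_le hRQ.symm (hA L hL) h hRL ▸ hL)
  have recover_inf {X : Submodule K (Fin 3 → K)} (hX : X ≤ L) :
      (P.submodule ⊔ X) ⊓ L = X := by
    rw [sup_comm, sup_inf_assoc_of_le P.submodule hX,
      Projectivization.inf_submodule_eq_bot hPL, sup_bot_eq]
  have recover {M : Submodule K (Fin 3 → K)} (hM : Q.submodule ≤ M) :
      Q.submodule ⊔ L ⊓ M = M := by
    rw [← sup_inf_assoc_of_le L hM, sup_eq_top_of_finrank_eq_two (hA L hL) hQL, top_inf_eq]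
  set f : Submodule K (Fin 3 → K) → Submodule K (Fin 3 → K) :=
    fun M => P.submodule ⊔ L ⊓ M
  have f_inf (M) : f M ⊓ L = L ⊓ M := recover_inf inf_le_left
  have hinj : Set.InjOn f (A.filter fun M => Q.submodule ≤ M) := by
    intro M hM N hN h
    have hM := (Finset.mem_filter.mp hM).2
    have hN := (Finset.mem_filter.mp hN).2
    rw [← recover hM, ← recover hN, ← f_inf M, ← f_inf N, h]
  rw [multAt, multAt, ← Finset.card_image_of_injOn hinj]
  refine Finset.card_lt_card (Finset.ssubset_iff_of_subset ?_ |>.mpr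
    ⟨P.submodule ⊔ R.submodule, Finset.mem_filter.mpr ⟨hPR, le_sup_left⟩, ?_⟩)
  · intro N hN
    obtain ⟨M, hM, rfl⟩ := Finset.mem_image.mp hN
    obtain ⟨hMA, hQM⟩ := Finset.mem_filter.mp hM
    refine Finset.mem_filter.mpr ⟨?_, le_sup_left⟩
    have hLM : ¬ M ≤ L := fun h => hQL (hQM.trans h)
    obtain ⟨X, hX⟩ := exists_submodule_eq_inf (hA M hMA) (hA L hL) hLM
    have hXL : X.submodule ≤ L := hX ▸ inf_le_right
    have hXS : X ∈ SingSet A :=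
      mem_singSet_of_mem hMA hL (fun h => hLM h.le) (hX ▸ inf_le_left) hXL
    have := hP.2 X hXS fun h => hPL (h ▸ hXL)
    rwa [hX, inf_comm] at this
  · intro h
    obtain ⟨M, hM, hfM⟩ := Finset.mem_image.mp h
    obtain ⟨hMA, hQM⟩ := Finset.mem_filter.mp hM
    have hRM : L ⊓ M = R.submodule := by rw [← f_inf M, hfM, recover_inf hRL]
    exact hQR (by rw [← hRM, recover hQM]; exact hMA)
end

section
/- Let 𝒜 be a full rank supersolvable line arrangement in the real projective plane ℙ²(ℝ), and let P ∈ Sing(𝒜) be a point of maximum multiplicity m(P,𝒜) = m(𝒜) (hence a modular point). Then every line of 𝒜 not passing through P contains at least one simple point of 𝒜. -/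
open scoped Classical

section Incidence

variable {K : Type*} [Field K]

/-- A point lies on a subspace iff its representative does. -/
theorem Projectivization.submodule_le_iff_rep_mem (P : Pt K) (L : Submodule K (Fin 3 → K)) :
    P.submodule ≤ L ↔ P.rep ∈ L := by
  rw [P.submodule_eq, Submodule.span_singleton_le_iff_mem]

theorem Projectivization.submodule_mk_le_iff_mem {w : Fin 3 → K} (hw : w ≠ 0)
    (L : Submodule K (Fin 3 → K)) : (Projectivization.mk K w hw).submodule ≤ L ↔ w ∈ L := by
  rw [Projectivization.submodule_mk, Submodule.span_singleton_le_iff_mem]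

/-- The join of two distinct points is a projective line. -/
theorem Projectivization.finrank_submodule_sup {P Q : Pt K} (h : P ≠ Q) :
    Module.finrank K (P.submodule ⊔ Q.submodule : Submodule K (Fin 3 → K)) = 2 := by
  have hdisj : P.submodule ⊓ Q.submodule = ⊥ := by
    by_contra hne
    have hpos : 1 ≤ Module.finrank K (P.submodule ⊓ Q.submodule : Submodule K (Fin 3 → K)) :=
      Submodule.one_le_finrank_iff.mpr hne
    have h1 : P.submodule ⊓ Q.submodule = P.submodule :=
      Submodule.eq_of_le_of_finrank_le inf_le_left (by rw [P.finrank_submodule]; exact hpos)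
    have h2 : P.submodule ⊓ Q.submodule = Q.submodule :=
      Submodule.eq_of_le_of_finrank_le inf_le_right (by rw [Q.finrank_submodule]; exact hpos)
    exact h (Projectivization.submodule_injective (h1.symm.trans h2))
  have := Submodule.finrank_sup_add_finrank_inf_eq P.submodule Q.submodule
  rw [hdisj, finrank_bot, P.finrank_submodule, Q.finrank_submodule] at this
  omega

/-- A line through two distinct points is their join. -/
theorem Projectivization.submodule_sup_eq {P Q : Pt K} (h : P ≠ Q)
    {L : Submodule K (Fin 3 → K)} (hL : Module.finrank K L = 2)
    (hP : P.submodule ≤ L) (hQ : Q.submodule ≤ L) : P.submodule ⊔ Q.submodule = L :=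
  Submodule.eq_of_le_of_finrank_eq (sup_le hP hQ)
    (by rw [Projectivization.finrank_submodule_sup h, hL])

/-- Any two lines in the plane have a common point. -/
theorem Projectivization.exists_submodule_le_of_finrank_eq_two {L M : Submodule K (Fin 3 → K)}
    (hL : Module.finrank K L = 2) (hM : Module.finrank K M = 2) :
    ∃ S : Pt K, S.submodule ≤ L ∧ S.submodule ≤ M := by
  have h1 := Submodule.finrank_sup_add_finrank_inf_eq L M
  have h2 := Submodule.finrank_le (L ⊔ M)
  rw [Module.finrank_fin_fun] at h2
  have h3 : L ⊓ M ≠ ⊥ := Submodule.one_le_finrank_iff.mp (by omega)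
  obtain ⟨w, hw, hw0⟩ := Submodule.exists_mem_ne_zero_of_ne_bot h3
  refine ⟨Projectivization.mk K w hw0, ?_, ?_⟩ <;>
    rw [Projectivization.submodule_mk_le_iff_mem]
  exacts [hw.1, hw.2]

/-- Two lines sharing two independent vectors are equal. -/
theorem Submodule.eq_of_finrank_eq_two {M N : Submodule K (Fin 3 → K)}
    (hM : Module.finrank K M = 2) (hN : Module.finrank K N = 2) {a b : Fin 3 → K} (ha : a ≠ 0)
    (hb : b ∉ Submodule.span K {a}) (haM : a ∈ M) (hbM : b ∈ M) (haN : a ∈ N) (hbN : b ∈ N) :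
    M = N := by
  have hb0 : b ≠ 0 := fun h => hb (h ▸ Submodule.zero_mem _)
  have hne : Projectivization.mk K a ha ≠ Projectivization.mk K b hb0 := fun h => hb <| by
    have := (Projectivization.submodule_mk_le_iff_mem hb0 (Submodule.span K {a})).mp
    exact this (h ▸ (Projectivization.submodule_mk_le_iff_mem ha _).mpr
      (Submodule.mem_span_singleton_self a))
  have h1 := Projectivization.submodule_sup_eq hne hM
    ((Projectivization.submodule_mk_le_iff_mem ha M).mpr haM)
    ((Projectivization.submodule_mk_le_iff_mem hb0 M).mpr hbM)
  have h2 := Projectivization.submodule_sup_eq hne hN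
    ((Projectivization.submodule_mk_le_iff_mem ha N).mpr haN)
    ((Projectivization.submodule_mk_le_iff_mem hb0 N).mpr hbN)
  exact h1.symm.trans h2

/-- A line meets every affine line whose direction it does not contain. -/
theorem Submodule.exists_add_smul_mem_of_finrank_eq_two {M : Submodule K (Fin 3 → K)}
    (hM : Module.finrank K M = 2) {p : Fin 3 → K} (hp : p ∉ M) (w : Fin 3 → K) :
    ∃ s : K, w + s • p ∈ M := by
  have hlt : M < M ⊔ Submodule.span K {p} := by
    refine lt_of_le_of_ne le_sup_left fun h => hp ?_
    rw [h]
    exact Submodule.mem_sup_right (Submodule.mem_span_singleton_self p)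
  have htop : M ⊔ Submodule.span K {p} = ⊤ := by
    apply Submodule.eq_top_of_finrank_eq
    have h1 := Submodule.finrank_lt_finrank_of_lt hlt
    have h2 := Submodule.finrank_le (M ⊔ Submodule.span K {p})
    rw [Module.finrank_fin_fun] at h2 ⊢
    omega
  have hw : w ∈ M ⊔ Submodule.span K {p} := htop ▸ Submodule.mem_top
  obtain ⟨y, hy, z, hz, rfl⟩ := Submodule.mem_sup.mp hw
  obtain ⟨c, rfl⟩ := Submodule.mem_span_singleton.mp hz
  exact ⟨-c, by simpa using hy⟩

theorem mem_singSet_of_two_lines {A : Arr K} {S : Pt K} {L M : Submodule K (Fin 3 → K)}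
    (hL : L ∈ A) (hM : M ∈ A) (hne : L ≠ M) (hSL : S.submodule ≤ L) (hSM : S.submodule ≤ M) :
    S ∈ SingSet A :=
  Finset.one_lt_card.mpr
    ⟨L, Finset.mem_filter.mpr ⟨hL, hSL⟩, M, Finset.mem_filter.mpr ⟨hM, hSM⟩, hne⟩

theorem exists_two_lines_of_mem_singSet {A : Arr K} {S : Pt K} (hS : S ∈ SingSet A) :
    ∃ L ∈ A, ∃ M ∈ A, L ≠ M ∧ S.submodule ≤ L ∧ S.submodule ≤ M := by
  obtain ⟨L, hL, M, hM, hne⟩ := Finset.one_lt_card.mp (show 1 < _ from hS)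
  rw [Finset.mem_filter] at hL hM
  exact ⟨L, hL.1, M, hM.1, hne, hL.2, hM.2⟩

theorem multAt_le_maxMult {A : Arr K} {Q : Pt K} (hQ : Q ∈ SingSet A) :
    multAt A Q ≤ maxMult A :=
  le_csSup ⟨A.card, by rintro _ ⟨R, -, rfl⟩; exact Finset.card_filter_le _ _⟩ ⟨Q, hQ, rfl⟩

/-- A singular point which is not modular has smaller multiplicity than any modular point. -/
theorem multAt_lt_of_not_isModular {A : Arr K} (hA : IsLineArr A) {P Q : Pt K}
    (hQ : IsModular A Q) (hP : P ∈ SingSet A) (hPmod : ¬ IsModular A P) :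
    multAt A P < multAt A Q := by
  have hPQ : P ≠ Q := fun h => hPmod (h ▸ hQ)
  obtain ⟨R, hR, hRP, hPR⟩ : ∃ R ∈ SingSet A, R ≠ P ∧ P.submodule ⊔ R.submodule ∉ A := by
    by_contra! h
    exact hPmod ⟨hP, h⟩
  have hRQ : R ≠ Q := by
    rintro rfl
    exact hPR (sup_comm P.submodule R.submodule ▸ hQ.2 P hP hPQ)
  obtain ⟨H, hH, hRH, hQH⟩ : ∃ H ∈ A, R.submodule ≤ H ∧ ¬ Q.submodule ≤ H := by
    obtain ⟨L, hL, M, hM, hne, hRL, hRM⟩ := exists_two_lines_of_mem_singSet hR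
    by_contra! h
    exact hne ((Projectivization.submodule_sup_eq hRQ (hA L hL) hRL (h L hL hRL)).symm.trans
      (Projectivization.submodule_sup_eq hRQ (hA M hM) hRM (h M hM hRM)))
  have hPH : ¬ P.submodule ≤ H := fun h =>
    hPR ((Projectivization.submodule_sup_eq hRP.symm (hA H hH) h hRH).symm ▸ hH)
  have hjoin : ∀ S T : Pt K, S.submodule ≤ H → T.submodule ≤ H →
      Q.submodule ⊔ S.submodule = Q.submodule ⊔ T.submodule → S = T := by
    intro S T hS hT h
    by_contra hne
    have hQS : Q ≠ S := by rintro rfl; exact hQH hS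
    have hT' : T.submodule ≤ Q.submodule ⊔ S.submodule := h ▸ le_sup_right
    have := Projectivization.submodule_sup_eq hne
      (Projectivization.finrank_submodule_sup hQS) le_sup_right hT'
    rw [Projectivization.submodule_sup_eq hne (hA H hH) hS hT] at this
    exact hQH (this ▸ le_sup_left)
  have hex : ∀ L : Submodule K (Fin 3 → K), ∃ S : Pt K,
      L ∈ A → S.submodule ≤ L ∧ S.submodule ≤ H := by
    intro L
    by_cases hL : L ∈ A
    · obtain ⟨S, hS⟩ := Projectivization.exists_submodule_le_of_finrank_eq_two (hA L hL) (hA H hH)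
      exact ⟨S, fun _ => hS⟩
    · exact ⟨P, fun h => absurd h hL⟩
  choose f hf using hex
  have hmem : ∀ S ∈ SingSet A, S.submodule ≤ H →
      Q.submodule ⊔ S.submodule ∈ A.filter fun L => Q.submodule ≤ L := fun S hS hSH =>
    Finset.mem_filter.mpr ⟨hQ.2 S hS (by rintro rfl; exact hQH hSH), le_sup_left⟩
  have hinj : Set.InjOn (fun L => Q.submodule ⊔ (f L).submodule)
      (A.filter fun L => P.submodule ≤ L) := by
    intro L hL M hM h
    rw [Finset.mem_coe, Finset.mem_filter] at hL hM
    have hLM := hjoin _ _ (hf L hL.1).2 (hf M hM.1).2 h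
    have hne : P ≠ f L := fun h => hPH (h ▸ (hf L hL.1).2)
    rw [← Projectivization.submodule_sup_eq hne (hA L hL.1) hL.2 (hf L hL.1).1,
      Projectivization.submodule_sup_eq hne (hA M hM.1) hM.2 (hLM ▸ (hf M hM.1).1)]
  unfold multAt
  rw [← Finset.card_image_of_injOn hinj]
  refine Finset.card_lt_card ((Finset.ssubset_iff_of_subset ?_).mpr
    ⟨_, hmem R hR hRH, fun h => ?_⟩)
  · intro N hN
    obtain ⟨L, hL, rfl⟩ := Finset.mem_image.mp hN
    rw [Finset.mem_filter] at hL
    exact hmem _ (mem_singSet_of_two_lines hL.1 hH (fun h => hPH (h ▸ hL.2))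
      (hf L hL.1).1 (hf L hL.1).2) (hf L hL.1).2
  · obtain ⟨L, hL, hLR⟩ := Finset.mem_image.mp h
    rw [Finset.mem_filter] at hL
    have := hjoin _ _ (hf L hL.1).2 hRH hLR
    exact hPR (Projectivization.submodule_sup_eq hRP.symm (hA L hL.1) hL.2
      (this ▸ (hf L hL.1).1) ▸ hL.1)

/-- In a supersolvable arrangement every point of maximum multiplicity is modular. -/
theorem Supersolvable.isModular_of_multAt_eq_maxMult {A : Arr K} (hA : IsLineArr A)
    (hss : Supersolvable A) {P : Pt K} (hP : P ∈ SingSet A) (hPmax : multAt A P = maxMult A) :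
    IsModular A P := by
  obtain ⟨Q, hQ⟩ := hss
  by_contra h
  exact absurd (multAt_lt_of_not_isModular hA hQ hP h)
    (hPmax ▸ multAt_le_maxMult hQ.1).not_gt

/-- A point of `L` on which two lines of `A` meet and which is not simple lies on a further line. -/
theorem exists_third_line {A : Arr K} {S : Pt K} {L M : Submodule K (Fin 3 → K)}
    (hL : L ∈ A) (hM : M ∈ A) (hne : L ≠ M) (hSL : S.submodule ≤ L) (hSM : S.submodule ≤ M)
    (hS : S ∉ Sing2Set A) : ∃ N ∈ A, S.submodule ≤ N ∧ N ≠ L ∧ N ≠ M := by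
  by_contra! h
  refine hS (le_antisymm ?_ (mem_singSet_of_two_lines hL hM hne hSL hSM))
  refine (Finset.card_le_card fun N hN => ?_).trans (Finset.card_le_two (a := L) (b := M))
  rw [Finset.mem_filter] at hN
  rw [Finset.mem_insert, Finset.mem_singleton]
  exact or_iff_not_imp_left.mpr (h N hN.1 hN.2)

end Incidence

/-- Consider the horizontal line of height `b ≠ 0` and, for each `x` in a finite nonempty set `X`,
a line of slope `s x ≠ 0` crossing the horizontal axis at `x`. These lines cannot all meet pairwise
above points of `X`. -/
theorem Finset.exists_crossing_notMem (X : Finset ℝ) (hX : X.Nonempty) (s : ℝ → ℝ) (b : ℝ)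
    (hb : b ≠ 0) (hs : ∀ x ∈ X, s x ≠ 0) (hhor : ∀ x ∈ X, x + b / s x ∈ X)
    (hcross : ∀ x ∈ X, ∀ y ∈ X, x ≠ y → s x ≠ s y → (s x * x - s y * y) / (s x - s y) ∈ X) :
    False := by
  have hdiv : ∀ x ∈ X, b / s x ≠ 0 := fun x hx => div_ne_zero hb (hs x hx)
  have hpos : (X.filter fun x => 0 < b / s x).Nonempty := by
    refine ⟨X.min' hX, Finset.mem_filter.mpr ⟨X.min'_mem hX, ?_⟩⟩
    have h := X.min'_le _ (hhor _ (X.min'_mem hX))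
    exact lt_of_le_of_ne (by linarith) (hdiv _ (X.min'_mem hX)).symm
  obtain ⟨x, hx, hxmax⟩ := Finset.exists_max_image _ id hpos
  rw [Finset.mem_filter] at hx
  have hgt : (X.filter fun y => x < y).Nonempty :=
    ⟨x + b / s x, Finset.mem_filter.mpr ⟨hhor x hx.1, by linarith⟩⟩
  obtain ⟨y, hy, hymin⟩ := Finset.exists_min_image _ id hgt
  rw [Finset.mem_filter] at hy
  have hyneg : b / s y < 0 := by
    refine lt_of_le_of_ne (not_lt.mp fun h => ?_) (hdiv y hy.1)
    exact absurd (hxmax y (Finset.mem_filter.mpr ⟨hy.1, h⟩)) (not_le.mpr hy.2)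
  obtain ⟨t, ht⟩ : ∃ t, t = b / s x := ⟨_, rfl⟩
  obtain ⟨r, hr⟩ : ∃ r, r = b / s y := ⟨_, rfl⟩
  have hsx : s x = b / t := by rw [ht, div_div_cancel₀ hb]
  have hsy : s y = b / r := by rw [hr, div_div_cancel₀ hb]
  have ht0 : 0 < t := ht ▸ hx.2
  have hr0 : r < 0 := hr ▸ hyneg
  have hrt : r - t ≠ 0 := by linarith
  have hst : s x - s y = b * (r - t) / (t * r) := by
    rw [hsx, hsy]; field_simp [ht0.ne', hr0.ne]
  have hne : s x ≠ s y := fun h => by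
    rw [h, sub_self] at hst
    exact div_ne_zero (mul_ne_zero hb hrt) (mul_ne_zero ht0.ne' hr0.ne) hst.symm
  have hz := hcross x hx.1 y hy.1 hy.2.ne hne
  have hzx : (s x * x - s y * y) / (s x - s y) = x + t * (y - x) / (t - r) := by
    rw [div_eq_iff (sub_ne_zero.mpr hne), hsx, hsy]
    have : t - r ≠ 0 := by linarith
    field_simp [ht0.ne', hr0.ne]
    ring
  rw [hzx] at hz
  have hlow : 0 < t * (y - x) / (t - r) :=
    div_pos (mul_pos ht0 (sub_pos.mpr hy.2)) (by linarith)
  have hupp : t * (y - x) / (t - r) < y - x := by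
    rw [div_lt_iff₀ (by linarith)]
    nlinarith [mul_pos_of_neg_of_neg hr0 (by linarith [hy.2] : x - y < 0)]
  have := hymin _ (Finset.mem_filter.mpr ⟨hz, by linarith⟩)
  simp only [id] at this
  linarith

/-- In a full rank supersolvable real line arrangement, every line not passing
through a point `P` of maximum multiplicity contains at least one simple point. -/
theorem line_off_max_modular_point_has_simple_point (A : Arr ℝ) (hA : IsLineArr A)
    (hfr : FullRank A) (hss : Supersolvable A) (P : Pt ℝ) (hP : P ∈ SingSet A)
    (hPmax : multAt A P = maxMult A) :
    ∀ L ∈ A, ¬ P.submodule ≤ L → ∃ P' ∈ Sing2Set A, P'.submodule ≤ L := by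
  intro L hL hPL
  have hmod := hss.isModular_of_multAt_eq_maxMult hA hP hPmax
  by_contra! hno
  obtain ⟨L₁, hL₁, L₂, hL₂, hL₁₂, hPL₁, hPL₂⟩ := exists_two_lines_of_mem_singSet hP
  obtain ⟨V, hVL, hVL₁⟩ :=
    Projectivization.exists_submodule_le_of_finrank_eq_two (hA L hL) (hA L₁ hL₁)
  have hLL₁ : L ≠ L₁ := fun h => hPL (h ▸ hPL₁)
  obtain ⟨M₀, hM₀, hVM₀, hM₀L, hM₀L₁⟩ :=
    exists_third_line hL hL₁ hLL₁ hVL hVL₁ fun h => hno V h hVL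
  simp only [Projectivization.submodule_le_iff_rep_mem] at hPL hPL₁ hPL₂ hVL hVL₁ hVM₀
  obtain ⟨p, hp⟩ : ∃ p, p = P.rep := ⟨_, rfl⟩
  obtain ⟨v, hv⟩ : ∃ v, v = V.rep := ⟨_, rfl⟩
  have hp0 : p ≠ 0 := hp ▸ P.rep_nonzero
  have hv0 : v ≠ 0 := hv ▸ V.rep_nonzero
  rw [← hp] at hPL hPL₁ hPL₂
  rw [← hv] at hVL hVL₁ hVM₀
  -- `u` and `v` span `L`
  obtain ⟨u, hu, huv⟩ : ∃ u ∈ L, u ∉ Submodule.span ℝ {v} := by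
    by_contra! h
    have h1 := Submodule.finrank_mono (show L ≤ Submodule.span ℝ {v} from h)
    rw [hA L hL, finrank_span_singleton hv0] at h1
    omega
  have hpv : p ∉ Submodule.span ℝ {v} := fun h =>
    hPL ((Submodule.span_singleton_le_iff_mem v L).mpr hVL h)
  have huvx : ∀ x : ℝ, u + x • v ∉ Submodule.span ℝ {v} := fun x h =>
    huv ((Submodule.add_mem_iff_left _ (Submodule.smul_mem _ _
      (Submodule.mem_span_singleton_self v))).mp h)
  have huvx0 : ∀ x : ℝ, u + x • v ≠ 0 := fun x h => huvx x (h ▸ Submodule.zero_mem _)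
  have huvL : ∀ x : ℝ, u + x • v ∈ L := fun x => L.add_mem hu (L.smul_mem x hVL)
  have huvM : ∀ M ∈ A, v ∈ M → M ≠ L → ∀ x : ℝ, u + x • v ∉ M := fun M hM hvM hML x h =>
    hML (Submodule.eq_of_finrank_eq_two (hA M hM) (hA L hL) hv0 (huvx x) hvM h hVL (huvL x))
  have hpuvx : ∀ x : ℝ, p ∉ Submodule.span ℝ {u + x • v} := fun x h =>
    hPL ((Submodule.span_singleton_le_iff_mem _ L).mpr (huvL x) h)
  -- the affine coordinates on `L` of the lines of `A` through `P` other than `L₁`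
  have hg : ∀ N : Submodule ℝ (Fin 3 → ℝ), ∃ x : ℝ, N ∈ A → v ∉ N → u + x • v ∈ N := by
    intro N
    by_cases h : N ∈ A ∧ v ∉ N
    · obtain ⟨x, hx⟩ := Submodule.exists_add_smul_mem_of_finrank_eq_two (hA N h.1) h.2 u
      exact ⟨x, fun _ _ => hx⟩
    · exact ⟨0, fun h1 h2 => absurd ⟨h1, h2⟩ h⟩
  choose g hg using hg
  obtain ⟨X, hX⟩ : ∃ X : Finset ℝ, ∀ x, x ∈ X ↔ ∃ N ∈ A, p ∈ N ∧ u + x • v ∈ N := by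
    refine ⟨(A.filter fun N => p ∈ N ∧ v ∉ N).image g, fun x => ?_⟩
    rw [Finset.mem_image]
    constructor
    · rintro ⟨N, hN, rfl⟩
      rw [Finset.mem_filter] at hN
      exact ⟨N, hN.1, hN.2.1, hg N hN.1 hN.2.2⟩
    · rintro ⟨N, hN, hpN, hx⟩
      have hvN : v ∉ N := fun h => huvM N hN h (fun h => hPL (h ▸ hpN)) x hx
      refine ⟨N, Finset.mem_filter.mpr ⟨hN, hpN, hvN⟩, ?_⟩
      by_contra hne
      have h1 := N.sub_mem (hg N hN hvN) hx
      rw [add_sub_add_left_eq_sub, ← sub_smul] at h1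
      exact hvN ((N.smul_mem_iff (sub_ne_zero.mpr hne)).mp h1)
  have hXne : X.Nonempty := by
    have hvL₂ : v ∉ L₂ := fun h => hL₁₂
      (Submodule.eq_of_finrank_eq_two (hA L₁ hL₁) (hA L₂ hL₂) hv0 hpv hVL₁ hPL₁ h hPL₂)
    exact ⟨g L₂, (hX _).mpr ⟨L₂, hL₂, hPL₂, hg L₂ hL₂ hvL₂⟩⟩
  have hmeet : ∀ M ∈ A, ∀ N ∈ A, M ≠ N → ∀ z c : ℝ,
      u + z • v + c • p ∈ M → u + z • v + c • p ∈ N → z ∈ X := by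
    intro M hM N hN hMN z c hwM hwN
    have hwp : u + z • v + c • p ∉ Submodule.span ℝ {p} := by
      intro h
      have h1 := (Submodule.add_mem_iff_left _ (Submodule.smul_mem _ c
        (Submodule.mem_span_singleton_self p))).mp h
      obtain ⟨k, hk⟩ := Submodule.mem_span_singleton.mp h1
      have hk0 : k ≠ 0 := by
        rintro rfl
        exact huvx0 z (by rw [← hk, zero_smul])
      exact hPL ((L.smul_mem_iff hk0).mp (hk ▸ huvL z))
    have hw0 : u + z • v + c • p ≠ 0 := fun h => hwp (h ▸ Submodule.zero_mem _)
    have hmk := fun T => Projectivization.submodule_mk_le_iff_mem hw0 T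
    have hjoin := hmod.2 (Projectivization.mk ℝ _ hw0)
      (mem_singSet_of_two_lines hM hN hMN ((hmk M).mpr hwM) ((hmk N).mpr hwN)) (by
        intro h
        apply hwp
        rw [← hmk, h, Projectivization.submodule_le_iff_rep_mem, ← hp]
        exact Submodule.mem_span_singleton_self p)
    have hpJ := (P.submodule_le_iff_rep_mem _).mp
      (le_sup_left (b := (Projectivization.mk ℝ _ hw0).submodule))
    rw [← hp] at hpJ
    exact (hX z).mpr ⟨_, hjoin, hpJ, (Submodule.add_mem_iff_left _
      (Submodule.smul_mem _ c hpJ)).mp ((hmk _).mp le_sup_right)⟩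
  -- the further line through the point of `L` on `L₁`
  have hpM₀ : p ∉ M₀ := fun h => hM₀L₁
    (Submodule.eq_of_finrank_eq_two (hA M₀ hM₀) (hA L₁ hL₁) hv0 hpv hVM₀ h hVL₁ hPL₁)
  obtain ⟨b, hbM₀⟩ := Submodule.exists_add_smul_mem_of_finrank_eq_two (hA M₀ hM₀) hpM₀ u
  have hb : b ≠ 0 := by
    rintro rfl
    exact huvM M₀ hM₀ hVM₀ hM₀L 0 (by simpa using hbM₀)
  -- the further lines through the remaining points of `L`
  have hthird : ∀ x : ℝ, ∃ (s : ℝ) (M : Submodule ℝ (Fin 3 → ℝ)),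
      x ∈ X → M ∈ A ∧ s ≠ 0 ∧ v ∉ M ∧ u + x • v ∈ M ∧ v + s • p ∈ M := by
    intro x
    by_cases hx : x ∈ X
    · obtain ⟨N, hN, hpN, hxN⟩ := (hX x).mp hx
      have hmk := fun T => Projectivization.submodule_mk_le_iff_mem (huvx0 x) T
      obtain ⟨M, hM, hxM, hML, hMN⟩ := exists_third_line hL hN (fun h => hPL (h ▸ hpN))
        ((hmk L).mpr (huvL x)) ((hmk N).mpr hxN) fun h => hno _ h ((hmk L).mpr (huvL x))
      rw [hmk] at hxM
      have hpM : p ∉ M := fun h => hMN (Submodule.eq_of_finrank_eq_two (hA M hM) (hA N hN)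
        (huvx0 x) (hpuvx x) hxM h hxN hpN)
      have hvM : v ∉ M := fun h => huvM M hM h hML x hxM
      obtain ⟨s, hs⟩ := Submodule.exists_add_smul_mem_of_finrank_eq_two (hA M hM) hpM v
      exact ⟨s, M, fun _ => ⟨hM, by rintro rfl; exact hvM (by simpa using hs), hvM, hxM, hs⟩⟩
    · exact ⟨0, ⊥, fun h => absurd h hx⟩
  choose s M hsM using hthird
  have hon : ∀ x ∈ X, ∀ t : ℝ, u + (x + t) • v + (t * s x) • p ∈ M x := by
    intro x hx t
    obtain ⟨-, -, -, h1, h2⟩ := hsM x hx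
    convert (M x).add_mem h1 ((M x).smul_mem t h2) using 1
    module
  refine X.exists_crossing_notMem hXne s b hb (fun x hx => (hsM x hx).2.1) (fun x hx => ?_)
    fun x hx y hy hxy hsxy => ?_
  · obtain ⟨hM, hs, hvM, -, -⟩ := hsM x hx
    refine hmeet (M x) hM M₀ hM₀ (fun h => hvM (h ▸ hVM₀)) _ b ?_ ?_
    · have := hon x hx (b / s x)
      rwa [div_mul_cancel₀ _ hs] at this
    · rw [add_right_comm]
      exact M₀.add_mem hbM₀ (M₀.smul_mem _ hVM₀)
  · have hne := sub_ne_zero.mpr hsxy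
    obtain ⟨z, hz⟩ : ∃ z, z = (s x * x - s y * y) / (s x - s y) := ⟨_, rfl⟩
    rw [← hz]
    have h1 := hon x hx (z - x)
    have h2 := hon y hy (z - y)
    have heq : (z - y) * s y = (z - x) * s x := by
      rw [eq_div_iff hne] at hz
      linarith
    rw [add_sub_cancel] at h1 h2
    rw [heq] at h2
    refine hmeet (M x) (hsM x hx).1 (M y) (hsM y hy).1 (fun h => (hsM x hx).2.2.1 ?_) z _ h1 h2
    have h3 := (M x).sub_mem (hsM x hx).2.2.2.1 (h ▸ (hsM y hy).2.2.2.1)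
    rw [add_sub_add_left_eq_sub, ← sub_smul] at h3
    exact ((M x).smul_mem_iff (sub_ne_zero.mpr hxy)).mp h3
end

section
/- Let 𝒜 be a full rank supersolvable line arrangement in the real projective plane ℙ²(ℝ). Then the number of simple points satisfies |Sing₂(𝒜)| ≥ |𝒜|/2. -/
open scoped Classical

section LinearOrder

variable {ι : Type*}

theorem card_filter_rank_lt_le (B : Finset ι) (h : ι → ℝ) (hh : Function.Injective h) (e : ℕ) :
    (B.filter fun y => (B.filter fun z => h z < h y).card < e).card ≤ e := by
  have key : ∀ y ∈ B, ∀ y' ∈ B, h y < h y' →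
      (B.filter fun z => h z < h y).card < (B.filter fun z => h z < h y').card := by
    intro y hy y' _ hlt
    apply Finset.card_lt_card
    rw [Finset.ssubset_iff_of_subset]
    · exact ⟨y, by simp [hy, hlt], by simp⟩
    · intro z hz
      simp only [Finset.mem_filter] at hz ⊢
      exact ⟨hz.1, hz.2.trans hlt⟩
  calc _ ≤ (Finset.range e).card := by
        apply Finset.card_le_card_of_injOn (fun y => (B.filter fun z => h z < h y).card)
        · intro y hy
          simp only [Finset.coe_filter, Set.mem_ofPred_eq] at hy
          simpa using hy.2
        · intro y hy y' hy' heq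
          simp only [Finset.coe_filter, Set.mem_ofPred_eq] at hy hy' heq
          rcases lt_trichotomy (h y) (h y') with hlt | hlt | hlt
          · exact absurd heq (key y hy.1 y' hy'.1 hlt).ne
          · exact hh hlt
          · exact absurd heq (key y' hy'.1 y hy.1 hlt).ne'
    _ = e := by simp

/-- `z` covers `y` in the order on `ι` induced by `h`. -/
def CoversVia (h : ι → ℝ) (y z : ι) : Prop :=
  h y < h z ∧ ∀ x, ¬ (h y < h x ∧ h x < h z)

theorem card_covers_ge [Fintype ι] (B : Finset ι) (h : ι → ℝ) (hh : Function.Injective h) (e : ℕ)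
    (hx : ∀ x, x ∉ B → (B.filter fun y => h x < h y).card ≤ e ∨
      (B.filter fun y => h y < h x).card ≤ e) :
    B.card - 1 - 2 * e ≤ (B.filter fun y => ∃ z ∈ B, CoversVia h y z).card := by
  have h1 := card_filter_rank_lt_le B h hh e
  have h2 := card_filter_rank_lt_le B (fun x => - h x) (neg_injective.comp hh) (e + 1)
  simp only [neg_lt_neg_iff] at h2
  have hsub : B ⊆ (B.filter fun y => ∃ z ∈ B, CoversVia h y z) ∪
      ((B.filter fun y => (B.filter fun z => h z < h y).card < e) ∪
      (B.filter fun y => (B.filter fun z => h y < h z).card < e + 1)) := by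
    intro y hy
    by_contra hcon
    simp only [Finset.mem_union, Finset.mem_filter, hy, true_and, not_or, not_lt] at hcon
    obtain ⟨hno, hlo, hhi⟩ := hcon
    have hne : (B.filter fun z => h y < h z).Nonempty := by
      rw [← Finset.card_pos]; omega
    obtain ⟨z, hz, hzmin⟩ := Finset.exists_min_image _ h hne
    simp only [Finset.mem_filter] at hz hzmin
    refine hno ⟨z, hz.1, hz.2, ?_⟩
    rintro x ⟨hyx, hxz⟩
    by_cases hxB : x ∈ B
    · exact absurd (hzmin x ⟨hxB, hyx⟩) (not_le.mpr hxz)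
    · rcases hx x hxB with hc | hc
      · have : (B.filter fun z => h y < h z).card ≤ (B.filter fun y => h x < h y).card := by
          apply Finset.card_le_card
          intro w hw
          simp only [Finset.mem_filter] at hw ⊢
          exact ⟨hw.1, hxz.trans_le (hzmin w hw)⟩
        omega
      · have : (B.filter fun z => h z < h y).card < (B.filter fun y => h y < h x).card := by
          apply Finset.card_lt_card
          rw [Finset.ssubset_iff_of_subset]
          · exact ⟨y, by simp [hy, hyx], by simp⟩
          · intro w hw
            simp only [Finset.mem_filter] at hw ⊢
            exact ⟨hw.1, hw.2.trans hyx⟩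
        omega
  have h3 := Finset.card_le_card hsub
  have h4 := Finset.card_union_le (B.filter fun y => ∃ z ∈ B, CoversVia h y z)
      ((B.filter fun y => (B.filter fun z => h z < h y).card < e) ∪
      (B.filter fun y => (B.filter fun z => h y < h z).card < e + 1))
  have h5 := Finset.card_union_le (B.filter fun y => (B.filter fun z => h z < h y).card < e)
      (B.filter fun y => (B.filter fun z => h y < h z).card < e + 1)
  omega

theorem card_exists_covers_le [Fintype ι] [Nonempty ι] (h : ι → ℝ) :
    (Finset.univ.filter fun y => ∃ z, CoversVia h y z).card ≤ Fintype.card ι - 1 := by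
  obtain ⟨w, -, hw⟩ := Finset.exists_max_image (Finset.univ : Finset ι) h Finset.univ_nonempty
  have : (Finset.univ.filter fun y => ∃ z, CoversVia h y z) ⊆ Finset.univ.erase w := by
    intro y hy
    simp only [Finset.mem_filter, Finset.mem_univ, true_and, Finset.mem_erase, and_true] at hy ⊢
    rintro rfl
    obtain ⟨z, hz, -⟩ := hy
    exact absurd (hw z (Finset.mem_univ z)) (not_le.mpr hz)
  simpa using Finset.card_le_card this

theorem CoversVia.unique {h : ι → ℝ} (hh : Function.Injective h) {y z z' : ι}
    (hz : CoversVia h y z) (hz' : CoversVia h y z') : z = z' := by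
  rcases lt_trichotomy (h z) (h z') with hlt | heq | hlt
  · exact absurd ⟨hz.1, hlt⟩ (hz'.2 z)
  · exact hh heq
  · exact absurd ⟨hz'.1, hlt⟩ (hz.2 z')

end LinearOrder

section CyclicDistance

/-- The number of columns `t k` separating the column `t i` from the gap `(t j, t (j + 1))` on the
shorter of the two arcs of the projective line joining them. -/
def arcDist {m : ℕ} (i j : Fin m) : ℕ :=
  if i ≤ j then min (j.val - i.val) (m - 1 - (j.val - i.val))
  else min (i.val - j.val - 1) (m - (i.val - j.val))

theorem sum_arcDist {m : ℕ} (i : Fin m) (F : ℕ → ℕ) :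
    ∑ j, F (arcDist i j) = ∑ k ∈ Finset.range m, F (min k (m - 1 - k)) := by
  have : NeZero m := ⟨by have := i.2; omega⟩
  rw [← Fin.sum_univ_eq_sum_range (fun k => F (min k (m - 1 - k)))]
  apply Fintype.sum_equiv (Equiv.subRight i)
  intro j
  congr 1
  have hi := i.2
  have hj := j.2
  simp only [arcDist, Equiv.subRight_apply, Fin.sub_def]
  split_ifs with hij
  · rw [Fin.le_def] at hij
    have : (m - i.val + j.val) % m = j.val - i.val := by
      rw [show m - i.val + j.val = (j.val - i.val) + m by omega, Nat.add_mod_right,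
        Nat.mod_eq_of_lt (by omega)]
    rw [this]
  · rw [Fin.le_def] at hij
    have : (m - i.val + j.val) % m = m - i.val + j.val := Nat.mod_eq_of_lt (by omega)
    rw [this]
    omega

theorem sum_range_odd_gaps (β h : ℕ) (hh : 2 * h ≤ β) :
    ∑ k ∈ Finset.range h, (β - 1 - 2 * k) = h * (β - h) := by
  induction h with
  | zero => simp
  | succ h ih =>
    rw [Finset.sum_range_succ, ih (by omega)]
    obtain ⟨c, rfl⟩ := Nat.exists_eq_add_of_le hh
    have e1 : 2 * (h + 1) + c - h = h + 2 + c := by omega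
    have e2 : 2 * (h + 1) + c - 1 - 2 * h = 1 + c := by omega
    have e3 : 2 * (h + 1) + c - (h + 1) = h + 1 + c := by omega
    rw [e1, e2, e3]
    ring

theorem le_sum_min_gaps {m β h : ℕ} (hm : 2 * h ≤ m) (hh : 2 * h ≤ β) :
    2 * (h * (β - h)) ≤ ∑ k ∈ Finset.range m, (β - 1 - 2 * min k (m - 1 - k)) := by
  have hsub : Finset.range h ∪ Finset.Ico (m - h) m ⊆ Finset.range m := by
    intro k hk
    simp only [Finset.mem_union, Finset.mem_range, Finset.mem_Ico] at hk ⊢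
    omega
  have hdisj : Disjoint (Finset.range h) (Finset.Ico (m - h) m) := by
    rw [Finset.disjoint_left]
    intro k hk hk'
    simp only [Finset.mem_range, Finset.mem_Ico] at hk hk'
    omega
  refine le_trans ?_ (Finset.sum_le_sum_of_subset hsub)
  rw [Finset.sum_union hdisj, two_mul, ← sum_range_odd_gaps β h hh]
  apply add_le_add
  · apply Finset.sum_le_sum
    intro k _
    omega
  · rw [Finset.sum_Ico_eq_sum_range, show m - (m - h) = h by omega,
      ← Finset.sum_range_reflect]
    apply Finset.sum_le_sum
    intro k hk
    simp only [Finset.mem_range] at hk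
    omega

end CyclicDistance

/-- Affine functions `s ↦ a x + b x * s` with distinct slopes, any two of which agree at one of the
columns `t 0 < t 1 < ⋯`, together with a sample point `τ j` to the right of each column `t j`. -/
structure LineSweep (ι : Type*) (m : ℕ) where
  /-- the intercepts -/
  a : ι → ℝ
  /-- the slopes -/
  b : ι → ℝ
  /-- the columns -/
  t : Fin m → ℝ
  /-- the sample points -/
  τ : Fin m → ℝ
  b_injective : Function.Injective b
  t_injective : Function.Injective t
  exists_cross : ∀ x y, x ≠ y → ∃ k, a x + b x * t k = a y + b y * t k
  t_lt_τ : ∀ j k, k ≤ j → t k < τ j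
  τ_lt_t : ∀ j k, j < k → τ j < t k

namespace LineSweep

variable {ι : Type*} {m : ℕ} (S : LineSweep ι m)

/-- The height of the line `x` over the parameter `s`. -/
def height (x : ι) (s : ℝ) : ℝ := S.a x + S.b x * s

theorem eq_of_height_eq {x y : ι} {s s' : ℝ} (h : S.height x s = S.height y s)
    (h' : S.height x s' = S.height y s') (hs : s ≠ s') : x = y := by
  unfold height at h h'
  have : (S.b x - S.b y) * (s - s') = 0 := by linear_combination h - h'
  rcases mul_eq_zero.mp this with h0 | h0
  · exact S.b_injective (sub_eq_zero.mp h0)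
  · exact absurd (sub_eq_zero.mp h0) hs

theorem height_sub (x y : ι) {s : ℝ} (h : S.height x s = S.height y s) (s' : ℝ) :
    S.height x s' - S.height y s' = (S.b x - S.b y) * (s' - s) := by
  unfold height at *
  linear_combination h

theorem τ_ne_t (j k : Fin m) : S.τ j ≠ S.t k := by
  rcases le_or_gt k j with h | h
  · exact (S.t_lt_τ j k h).ne'
  · exact (S.τ_lt_t j k h).ne

theorem height_τ_injective (j : Fin m) : Function.Injective fun x => S.height x (S.τ j) := by
  intro x y hxy
  by_contra hne
  obtain ⟨k, hk⟩ := S.exists_cross x y hne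
  exact hne (S.eq_of_height_eq hxy hk (S.τ_ne_t j k))

theorem t_lt_t {j k : Fin m} (h : j < k) : S.t j < S.t k :=
  (S.t_lt_τ j j le_rfl).trans (S.τ_lt_t j k h)

theorem card_between_le (i j : Fin m) :
    min (Finset.univ.filter fun k => 0 < (-1 : ℝ) * ((S.t i - S.t k) * (S.τ j - S.t k))).card
      (Finset.univ.filter fun k => 0 < (1 : ℝ) * ((S.t i - S.t k) * (S.τ j - S.t k))).card ≤
    arcDist i j := by
  have hτ : ∀ k, (k ≤ j → 0 < S.τ j - S.t k) ∧ (j < k → S.τ j - S.t k < 0) := fun k =>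
    ⟨fun h => sub_pos.mpr (S.t_lt_τ j k h), fun h => sub_neg.mpr (S.τ_lt_t j k h)⟩
  have ht : ∀ k, (k < i → 0 < S.t i - S.t k) ∧ (i < k → S.t i - S.t k < 0) := fun k =>
    ⟨fun h => sub_pos.mpr (S.t_lt_t h), fun h => sub_neg.mpr (S.t_lt_t h)⟩
  have hneg : ∀ k, 0 < (-1 : ℝ) * ((S.t i - S.t k) * (S.τ j - S.t k)) →
      (i < k ∧ k ≤ j) ∨ (k < i ∧ j < k) := by
    intro k hk
    rcases lt_trichotomy k i with h | rfl | h
    · refine Or.inr ⟨h, ?_⟩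
      by_contra hc
      nlinarith [mul_pos ((ht k).1 h) ((hτ k).1 (not_lt.mp hc))]
    · simp at hk
    · refine Or.inl ⟨h, ?_⟩
      by_contra hc
      nlinarith [mul_pos_of_neg_of_neg ((ht k).2 h) ((hτ k).2 (not_le.mp hc))]
  have hpos : ∀ k, 0 < (1 : ℝ) * ((S.t i - S.t k) * (S.τ j - S.t k)) →
      (i < k ∧ j < k) ∨ (k < i ∧ k ≤ j) := by
    intro k hk
    rcases lt_trichotomy k i with h | rfl | h
    · refine Or.inr ⟨h, ?_⟩
      by_contra hc
      nlinarith [mul_neg_of_pos_of_neg ((ht k).1 h) ((hτ k).2 (not_le.mp hc))]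
    · simp at hk
    · refine Or.inl ⟨h, ?_⟩
      by_contra hc
      nlinarith [mul_neg_of_neg_of_pos ((ht k).2 h) ((hτ k).1 (not_lt.mp hc))]
  have hi := i.2
  have hj := j.2
  unfold arcDist
  split_ifs with hij
  · have h1 : (Finset.univ.filter fun k =>
        0 < (-1 : ℝ) * ((S.t i - S.t k) * (S.τ j - S.t k))) ⊆ Finset.Ioc i j := by
      intro k hk
      simp only [Finset.mem_filter, Finset.mem_univ, true_and, Finset.mem_Ioc] at hk ⊢
      have := hneg k hk
      omega
    have h2 : (Finset.univ.filter fun k =>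
        0 < (1 : ℝ) * ((S.t i - S.t k) * (S.τ j - S.t k))) ⊆ (Finset.Icc i j)ᶜ := by
      intro k hk
      simp only [Finset.mem_filter, Finset.mem_univ, true_and, Finset.mem_compl,
        Finset.mem_Icc] at hk ⊢
      have := hpos k hk
      omega
    have h1 := Finset.card_le_card h1
    have h2 := Finset.card_le_card h2
    rw [Fin.card_Ioc] at h1
    rw [Finset.card_compl, Fin.card_Icc, Fintype.card_fin] at h2
    rw [Fin.le_def] at hij
    omega
  · have h1 : (Finset.univ.filter fun k =>
        0 < (-1 : ℝ) * ((S.t i - S.t k) * (S.τ j - S.t k))) ⊆ Finset.Ioo j i := by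
      intro k hk
      simp only [Finset.mem_filter, Finset.mem_univ, true_and, Finset.mem_Ioo] at hk ⊢
      have := hneg k hk
      omega
    have h2 : (Finset.univ.filter fun k =>
        0 < (1 : ℝ) * ((S.t i - S.t k) * (S.τ j - S.t k))) ⊆ (Finset.Ioc j i)ᶜ := by
      intro k hk
      simp only [Finset.mem_filter, Finset.mem_univ, true_and, Finset.mem_compl,
        Finset.mem_Ioc] at hk ⊢
      have := hpos k hk
      omega
    have h1 := Finset.card_le_card h1
    have h2 := Finset.card_le_card h2
    rw [Fin.card_Ioo] at h1
    rw [Finset.card_compl, Fin.card_Ioc, Fintype.card_fin] at h2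
    rw [Fin.le_def] at hij
    omega

section Fintype

variable [Fintype ι]

/-- The lines passing through the point of height `v` on the column `q.1`. -/
noncomputable def block (q : Fin m × ℝ) : Finset ι :=
  Finset.univ.filter fun x => S.height x (S.t q.1) = q.2

@[simp] theorem mem_block {q : Fin m × ℝ} {x : ι} :
    x ∈ S.block q ↔ S.height x (S.t q.1) = q.2 := by simp [block]

/-- The points where a line meets a column. -/
noncomputable def pts : Finset (Fin m × ℝ) :=
  Finset.univ.image fun p : Fin m × ι => (p.1, S.height p.2 (S.t p.1))

theorem mem_pts_of_mem_block {q : Fin m × ℝ} {x : ι} (h : x ∈ S.block q) : q ∈ S.pts := by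
  rw [mem_block] at h
  simp only [pts, Finset.mem_image, Finset.mem_univ, true_and, Prod.exists]
  exact ⟨q.1, x, Prod.ext rfl h⟩

theorem block_nonempty {q : Fin m × ℝ} (h : q ∈ S.pts) : (S.block q).Nonempty := by
  simp only [pts, Finset.mem_image, Finset.mem_univ, true_and, Prod.exists] at h
  obtain ⟨i, x, rfl⟩ := h
  exact ⟨x, by simp⟩

/-- Lines of a block meet a line outside the block on distinct columns. -/
theorem exists_cross_injOn {q : Fin m × ℝ} {x : ι} (hx : x ∉ S.block q) :
    ∃ k : ι → Fin m, Set.InjOn k (S.block q) ∧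
      ∀ y ∈ S.block q, k y ≠ q.1 ∧ S.height x (S.t (k y)) = S.height y (S.t (k y)) := by
  have : Nonempty (Fin m) := ⟨q.1⟩
  have hex : ∀ y ∈ S.block q, ∃ k, S.height x (S.t k) = S.height y (S.t k) := by
    intro y hy
    exact S.exists_cross x y (by rintro rfl; exact hx hy)
  choose! k hk using hex
  have hne : ∀ y ∈ S.block q, k y ≠ q.1 := by
    intro y hy h
    have := hk y hy
    rw [mem_block] at hx hy
    rw [h, hy] at this
    exact hx this
  refine ⟨k, ?_, fun y hy => ⟨hne y hy, hk y hy⟩⟩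
  intro y hy y' hy' hyy
  have h1 := hk y hy
  have h2 := hk y' hy'
  rw [← hyy] at h2
  have h3 := hne y hy
  rw [Finset.mem_coe, mem_block] at hy hy'
  exact S.eq_of_height_eq (h1.symm.trans h2) (hy.trans hy'.symm)
    (fun h => h3 (S.t_injective h))

theorem card_block_lt {q : Fin m × ℝ} {x : ι} (hx : x ∉ S.block q) : (S.block q).card < m := by
  obtain ⟨k, hinj, hk⟩ := S.exists_cross_injOn hx
  have h := Finset.card_le_card_of_injOn (t := Finset.univ.erase q.1) k
    (fun y hy => by simpa using (hk y hy).1) hinj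
  have := q.1.2
  simp only [Finset.card_erase_of_mem (Finset.mem_univ _), Finset.card_univ,
    Fintype.card_fin] at h
  omega

theorem card_block_side_le {q : Fin m × ℝ} {x : ι} (hx : x ∉ S.block q) (s r : ℝ) :
    ((S.block q).filter fun y =>
      0 < r * ((S.height x (S.t q.1) - q.2) * (S.height x s - S.height y s))).card ≤
    (Finset.univ.filter fun k => 0 < r * ((S.t q.1 - S.t k) * (s - S.t k))).card := by
  obtain ⟨k, hinj, hk⟩ := S.exists_cross_injOn hx
  refine Finset.card_le_card_of_injOn k ?_ (hinj.mono (Finset.coe_subset.mpr (Finset.filter_subset _ _)))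
  intro y hy
  simp only [Finset.coe_filter, Set.mem_ofPred_eq, Finset.mem_univ, true_and] at hy ⊢
  obtain ⟨hy, hpos⟩ := hy
  have h := (hk y hy).2
  rw [mem_block] at hy
  rw [← hy, S.height_sub x y h, S.height_sub x y h] at hpos
  have hb : 0 ≤ (S.b x - S.b y) ^ 2 := sq_nonneg _
  by_contra hcon
  rw [not_lt] at hcon
  nlinarith [mul_nonneg hb (neg_nonneg.mpr hcon)]

/-- The pairs of lines adjacent over the sample point `τ j` which cross at `q`, recorded by their
lower line. -/
noncomputable def coversAt (q : Fin m × ℝ) (j : Fin m) : Finset ι :=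
  (S.block q).filter fun y => ∃ z ∈ S.block q, CoversVia (fun x => S.height x (S.τ j)) y z

theorem card_coversAt_ge (q : Fin m × ℝ) (j : Fin m) :
    (S.block q).card - 1 - 2 * arcDist q.1 j ≤ (S.coversAt q j).card := by
  apply card_covers_ge _ _ (S.height_τ_injective j)
  intro x hx
  have h0 := S.card_between_le q.1 j
  have h1 := S.card_block_side_le hx (S.τ j) (-1)
  have h2 := S.card_block_side_le hx (S.τ j) 1
  have hx' : S.height x (S.t q.1) - q.2 ≠ 0 := by
    rw [mem_block] at hx
    exact sub_ne_zero.mpr hx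
  rcases lt_or_gt_of_ne hx' with hlt | hlt
  · have e1 : ((S.block q).filter fun y => S.height y (S.τ j) < S.height x (S.τ j)).card ≤
        ((S.block q).filter fun y => 0 < (-1) * ((S.height x (S.t q.1) - q.2) *
          (S.height x (S.τ j) - S.height y (S.τ j)))).card := by
      apply Finset.card_le_card
      apply Finset.monotone_filter_right
      intro y _ hy
      nlinarith [mul_neg_of_neg_of_pos hlt (sub_pos.mpr hy)]
    have e2 : ((S.block q).filter fun y => S.height x (S.τ j) < S.height y (S.τ j)).card ≤
        ((S.block q).filter fun y => 0 < 1 * ((S.height x (S.t q.1) - q.2) *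
          (S.height x (S.τ j) - S.height y (S.τ j)))).card := by
      apply Finset.card_le_card
      apply Finset.monotone_filter_right
      intro y _ hy
      nlinarith [mul_pos_of_neg_of_neg hlt (sub_neg.mpr hy)]
    omega
  · have e1 : ((S.block q).filter fun y => S.height x (S.τ j) < S.height y (S.τ j)).card ≤
        ((S.block q).filter fun y => 0 < (-1) * ((S.height x (S.t q.1) - q.2) *
          (S.height x (S.τ j) - S.height y (S.τ j)))).card := by
      apply Finset.card_le_card
      apply Finset.monotone_filter_right
      intro y _ hy
      nlinarith [mul_neg_of_pos_of_neg hlt (sub_neg.mpr hy)]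
    have e2 : ((S.block q).filter fun y => S.height y (S.τ j) < S.height x (S.τ j)).card ≤
        ((S.block q).filter fun y => 0 < 1 * ((S.height x (S.t q.1) - q.2) *
          (S.height x (S.τ j) - S.height y (S.τ j)))).card := by
      apply Finset.card_le_card
      apply Finset.monotone_filter_right
      intro y _ hy
      nlinarith [mul_pos hlt (sub_pos.mpr hy)]
    omega

theorem eq_of_mem_block {q q' : Fin m × ℝ} {y z : ι} (hyz : y ≠ z) (hy : y ∈ S.block q)
    (hz : z ∈ S.block q) (hy' : y ∈ S.block q') (hz' : z ∈ S.block q') : q = q' := by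
  rw [mem_block] at *
  by_cases h : q.1 = q'.1
  · refine Prod.ext h ?_
    rw [← hy, ← hy', h]
  · exact absurd (S.eq_of_height_eq (hy.trans hz.symm) (hy'.trans hz'.symm)
      fun h' => h (S.t_injective h')) hyz

theorem sum_card_coversAt_le [Nonempty ι] (j : Fin m) :
    ∑ q ∈ S.pts, (S.coversAt q j).card ≤ Fintype.card ι - 1 := by
  rw [← Finset.card_biUnion]
  · refine le_trans (Finset.card_le_card ?_)
      (card_exists_covers_le fun x => S.height x (S.τ j))
    intro y hy
    simp only [Finset.mem_biUnion, coversAt, Finset.mem_filter, Finset.mem_univ, true_and] at hy ⊢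
    obtain ⟨q, -, -, z, -, hz⟩ := hy
    exact ⟨z, hz⟩
  · intro q _ q' _ hqq
    rw [Function.onFun, Finset.disjoint_left]
    intro y hy hy'
    simp only [coversAt, Finset.mem_filter] at hy hy'
    obtain ⟨hyq, z, hzq, hz⟩ := hy
    obtain ⟨hyq', z', hzq', hz'⟩ := hy'
    obtain rfl := hz.unique (S.height_τ_injective j) hz'
    exact hqq (S.eq_of_mem_block (by rintro rfl; exact lt_irrefl _ hz.1) hyq hzq hyq' hzq')

theorem sum_gaps_le [Nonempty ι] :
    ∑ q ∈ S.pts, ∑ k ∈ Finset.range m, ((S.block q).card - 1 - 2 * min k (m - 1 - k)) ≤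
      m * (Fintype.card ι - 1) := by
  calc _ = ∑ q ∈ S.pts, ∑ j, ((S.block q).card - 1 - 2 * arcDist q.1 j) := by
        refine Finset.sum_congr rfl fun q _ => ?_
        rw [sum_arcDist q.1 fun d => (S.block q).card - 1 - 2 * d]
    _ ≤ ∑ q ∈ S.pts, ∑ j, (S.coversAt q j).card :=
        Finset.sum_le_sum fun q _ => Finset.sum_le_sum fun j _ => S.card_coversAt_ge q j
    _ = ∑ j, ∑ q ∈ S.pts, (S.coversAt q j).card := Finset.sum_comm
    _ ≤ ∑ _j : Fin m, (Fintype.card ι - 1) :=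
        Finset.sum_le_sum fun j _ => S.sum_card_coversAt_le j
    _ = _ := by simp

theorem sum_card_block : ∑ q ∈ S.pts, (S.block q).card = m * Fintype.card ι := by
  have h := Finset.card_eq_sum_card_image (fun p : Fin m × ι => (p.1, S.height p.2 (S.t p.1)))
    Finset.univ
  rw [Finset.card_univ, Fintype.card_prod, Fintype.card_fin] at h
  rw [h]
  refine Finset.sum_congr rfl fun q _ => ?_
  refine Finset.card_bij (fun x _ => (q.1, x)) ?_ ?_ ?_
  · intro x hx
    rw [mem_block] at hx
    simp [hx]
  · intro x _ y _ h
    exact (Prod.ext_iff.mp h).2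
  · rintro ⟨i, x⟩ hx
    simp only [Finset.mem_filter, Finset.mem_univ, true_and] at hx
    subst hx
    exact ⟨x, by simp, rfl⟩

theorem sum_card_offDiag_block :
    ∑ q ∈ S.pts, (S.block q).offDiag.card = (Finset.univ : Finset ι).offDiag.card := by
  rw [← Finset.card_biUnion]
  · congr 1
    ext ⟨x, y⟩
    simp only [Finset.mem_biUnion, Finset.mem_offDiag, Finset.mem_univ, true_and]
    constructor
    · rintro ⟨q, -, -, -, h⟩
      exact h
    · intro h
      obtain ⟨k, hk⟩ := S.exists_cross x y h
      have hx : x ∈ S.block (k, S.height x (S.t k)) := by simp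
      exact ⟨_, S.mem_pts_of_mem_block hx, hx, by rw [mem_block]; exact hk.symm, h⟩
  · intro q _ q' _ hqq
    rw [Function.onFun, Finset.disjoint_left]
    rintro ⟨x, y⟩ h h'
    rw [Finset.mem_offDiag] at h h'
    exact hqq (S.eq_of_mem_block h.2.2 h.1 h.2.1 h'.1 h'.2.1)

/-- The points lying on exactly one line. -/
noncomputable def simplePts : Finset (Fin m × ℝ) :=
  S.pts.filter fun q => (S.block q).card = 1

theorem card_simplePts_of_concurrent {q : Fin m × ℝ} (hq : ∀ x, x ∈ S.block q) :
    (m - 1) * Fintype.card ι ≤ S.simplePts.card := by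
  have hcard : ((Finset.univ.erase q.1) ×ˢ (Finset.univ : Finset ι)).card =
      (m - 1) * Fintype.card ι := by
    simp [Finset.card_product, Finset.card_erase_of_mem]
  have key : ∀ i, i ≠ q.1 → ∀ x y, S.height x (S.t i) = S.height y (S.t i) → x = y := by
    intro i hi x y h
    have hx := hq x
    have hy := hq y
    rw [mem_block] at hx hy
    exact S.eq_of_height_eq h (hx.trans hy.symm) fun h' => hi (S.t_injective h')
  rw [← hcard]
  refine Finset.card_le_card_of_injOn (fun p => (p.1, S.height p.2 (S.t p.1))) ?_ ?_
  · rintro ⟨i, x⟩ hp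
    simp only [Finset.coe_product, Set.mem_prod, Finset.mem_coe, Finset.mem_erase,
      Finset.mem_univ, and_true] at hp
    have hx : x ∈ S.block (i, S.height x (S.t i)) := by simp
    simp only [simplePts, Finset.coe_filter, Set.mem_ofPred_eq]
    refine ⟨S.mem_pts_of_mem_block hx, Finset.card_eq_one.mpr ⟨x, ?_⟩⟩
    ext y
    rw [mem_block, Finset.mem_singleton]
    exact ⟨fun h => key i hp y x h, by rintro rfl; rfl⟩
  · rintro ⟨i, x⟩ hp ⟨i', y⟩ _ h
    simp only [Finset.coe_product, Set.mem_prod, Finset.mem_coe, Finset.mem_erase,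
      Finset.mem_univ, and_true] at hp
    simp only [Prod.mk.injEq] at h
    obtain ⟨rfl, h⟩ := h
    rw [key i hp x y h]

theorem le_two_mul_card_simplePts [Nonempty ι] (hm : 2 ≤ m) :
    m + Fintype.card ι ≤ 2 * S.simplePts.card := by
  have hn : 1 ≤ Fintype.card ι := Fintype.card_pos
  have hsimple : (S.simplePts.card : ℤ) =
      ∑ q ∈ S.pts, if (S.block q).card = 1 then 1 else 0 := by
    simp [simplePts, Finset.sum_boole]
  have hpos : ∀ q ∈ S.pts, 1 ≤ (S.block q).card := fun q hq =>
    Finset.card_pos.mpr (S.block_nonempty hq)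
  have hβ : (∑ q ∈ S.pts, ((S.block q).card : ℤ)) = m * Fintype.card ι := by
    exact_mod_cast S.sum_card_block
  have hgap : (∑ q ∈ S.pts, ∑ k ∈ Finset.range m,
      (((S.block q).card - 1 - 2 * min k (m - 1 - k) : ℕ) : ℤ)) ≤ m * (Fintype.card ι - 1) := by
    have := S.sum_gaps_le
    zify [hn] at this
    exact_mod_cast this
  have hX : (∑ q ∈ S.pts, 2 * (((S.block q).card : ℤ) - 1)) ≤ m * (Fintype.card ι - 1) := by
    refine le_trans (Finset.sum_le_sum fun q hq => ?_) hgap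
    rcases (hpos q hq).eq_or_lt with h1 | h1
    · rw [← h1]
      simp
    · have := le_sum_min_gaps (m := m) (β := (S.block q).card) (h := 1) (by omega) (by omega)
      zify [hpos q hq] at this
      linarith
  rcases lt_or_ge (Fintype.card ι) m with hnm | hnm
  · have hS : (m : ℤ) ≤ S.simplePts.card := by
      have : (∑ q ∈ S.pts, (((S.block q).card : ℤ) - 2 * (((S.block q).card : ℤ) - 1))) ≤
          S.simplePts.card := by
        rw [hsimple]
        refine Finset.sum_le_sum fun q hq => ?_
        have := hpos q hq
        split_ifs <;> omega
      rw [Finset.sum_sub_distrib, hβ] at this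
      linarith
    omega
  by_cases hconc : ∃ q, ∀ x, x ∈ S.block q
  · obtain ⟨q, hq⟩ := hconc
    have h := S.card_simplePts_of_concurrent hq
    obtain ⟨k, rfl⟩ := Nat.exists_eq_add_of_le hm
    have h2 : 2 + k - 1 = k + 1 := by omega
    rw [h2] at h
    nlinarith
  push Not at hconc
  have hlt : ∀ q, (S.block q).card < m := fun q => S.card_block_lt (hconc q).choose_spec
  have hY : (∑ q ∈ S.pts, 2 * (((S.block q).card / 2 : ℤ) *
      ((S.block q).card - (S.block q).card / 2))) ≤ m * (Fintype.card ι - 1) := by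
    refine le_trans (Finset.sum_le_sum fun q hq => ?_) hgap
    have := le_sum_min_gaps (m := m) (β := (S.block q).card) (h := (S.block q).card / 2)
      (by have := hlt q; omega) (by omega)
    zify [Nat.div_le_self (S.block q).card 2] at this
    exact_mod_cast this
  have hZ : (∑ q ∈ S.pts, ((S.block q).card : ℤ) * ((S.block q).card - 1)) =
      Fintype.card ι * (Fintype.card ι - 1) := by
    have h := S.sum_card_offDiag_block
    simp only [Finset.offDiag_card, Finset.card_univ] at h
    zify at h
    rw [Nat.cast_sub (Nat.le_mul_self _)] at h
    push_cast at h
    rw [mul_sub_one, ← h]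
    refine Finset.sum_congr rfl fun q _ => ?_
    rw [Nat.cast_sub (Nat.le_mul_self _)]
    push_cast
    ring
  have hS : (∑ q ∈ S.pts, (((S.block q).card : ℤ) * ((S.block q).card - 1) +
      (S.block q).card + (S.block q).card - 2 * (((S.block q).card : ℤ) - 1) -
      2 * (2 * (((S.block q).card / 2 : ℤ) *
      ((S.block q).card - (S.block q).card / 2))))) ≤ 2 * S.simplePts.card := by
    rw [hsimple, Finset.mul_sum]
    refine Finset.sum_le_sum fun q hq => ?_
    have h1 := hpos q hq
    generalize (S.block q).card = β at h1
    rcases Nat.even_or_odd' β with ⟨c, rfl | rfl⟩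
    · have : ((2 * c : ℕ) : ℤ) / 2 = c := by omega
      rw [this, if_neg (by omega)]
      have : (1 : ℤ) ≤ c := by omega
      push_cast
      nlinarith
    · have : ((2 * c + 1 : ℕ) : ℤ) / 2 = c := by omega
      rw [this]
      push_cast
      split_ifs with hc
      · have : c = 0 := by omega
        subst this
        simp
      · have : (1 : ℤ) ≤ c := by omega
        nlinarith
  rw [Finset.sum_sub_distrib, Finset.sum_sub_distrib, Finset.sum_add_distrib,
    Finset.sum_add_distrib, hβ, hZ, ← Finset.mul_sum S.pts (fun q =>
      2 * (((S.block q).card / 2 : ℤ) * ((S.block q).card - (S.block q).card / 2))) 2] at hS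
  have hnm' : (m : ℤ) ≤ Fintype.card ι := by exact_mod_cast hnm
  have hm' : (2 : ℤ) ≤ m := by exact_mod_cast hm
  zify
  generalize (Fintype.card ι : ℤ) = n at *
  nlinarith [mul_nonneg (sub_nonneg.mpr hnm') (sub_nonneg.mpr (hm'.trans hnm'))]

end Fintype

end LineSweep

theorem exists_ker_eq {K V : Type*} [Field K] [AddCommGroup V] [Module K V] [FiniteDimensional K V]
    {L : Submodule K V} (hL : Module.finrank K L + 1 = Module.finrank K V) :
    ∃ φ : V →ₗ[K] K, LinearMap.ker φ = L := by
  have hlt : L < ⊤ := by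
    rw [lt_top_iff_ne_top]
    rintro rfl
    rw [finrank_top] at hL
    omega
  obtain ⟨φ, hφ, hle⟩ := L.exists_le_ker_of_lt_top hlt
  refine ⟨φ, (Submodule.eq_of_le_of_finrank_eq hle ?_).symm⟩
  have := Module.Dual.finrank_ker_add_one_of_ne_zero hφ
  omega

/-- Points `s` with strictly increasing coordinates admit interlacing sample points. -/
theorem exists_interlacing {m : ℕ} (t : Fin m → ℝ) (ht : StrictMono t) :
    ∃ τ : Fin m → ℝ, (∀ j k, k ≤ j → t k < τ j) ∧ ∀ j k, j < k → τ j < t k := by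
  have : ∀ j, ∃ s, t j < s ∧ ∀ k, j < k → s < t k := by
    intro j
    by_cases hj : j.val + 1 < m
    · obtain ⟨s, hs, hs'⟩ := exists_between (ht (show j < ⟨j.val + 1, hj⟩ by simp [Fin.lt_def]))
      refine ⟨s, hs, fun k hk => hs'.trans_le (ht.monotone ?_)⟩
      rw [Fin.le_def]
      exact hk
    · refine ⟨t j + 1, by linarith, fun k hk => ?_⟩
      have := k.2
      omega
  choose τ h1 h2 using this
  exact ⟨τ, fun j k hk => (ht.monotone hk).trans_lt (h1 j), h2⟩

theorem multAt_mk {K : Type*} [Field K] (A : Arr K) (q : Fin 3 → K) (hq : q ≠ 0) :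
    multAt A (Projectivization.mk K q hq) = (A.filter fun L => q ∈ L).card := by
  simp [multAt, Projectivization.submodule_mk, Submodule.span_singleton_le_iff_mem]

theorem exists_ne_zero_mem_inf {K : Type*} [Field K] {L M : Submodule K (Fin 3 → K)}
    (hL : Module.finrank K L = 2) (hM : Module.finrank K M = 2) :
    ∃ q, q ≠ 0 ∧ q ∈ L ∧ q ∈ M := by
  have h1 := Submodule.finrank_sup_add_finrank_inf_eq L M
  have h2 := Submodule.finrank_le (L ⊔ M)
  rw [Module.finrank_fin_fun] at h2
  have h3 : (L ⊓ M) ≠ ⊥ := by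
    intro h
    rw [h, finrank_bot] at h1
    omega
  obtain ⟨q, hq, hq0⟩ := Submodule.exists_mem_ne_zero_of_ne_bot h3
  exact ⟨q, hq0, hq.1, hq.2⟩

theorem two_le_card_filter_mem {K : Type*} [Field K] {A : Arr K} {L M : Submodule K (Fin 3 → K)}
    (hL : L ∈ A) (hM : M ∈ A) (hne : L ≠ M) {q : Fin 3 → K} (hqL : q ∈ L) (hqM : q ∈ M) :
    2 ≤ (A.filter fun L => q ∈ L).card :=
  Finset.one_lt_card.mpr ⟨L, by simp [hL, hqL], M, by simp [hM, hqM], hne⟩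

theorem finite_sing2Set {K : Type*} [Field K] {A : Arr K} (hA : IsLineArr A) :
    (Sing2Set A).Finite := by
  refine Set.Finite.of_finite_image (f := Projectivization.submodule)
    (((A ×ˢ A).finite_toSet.image fun x => x.1 ⊓ x.2).subset ?_)
    Projectivization.submodule_injective.injOn
  rintro _ ⟨P, hP, rfl⟩
  obtain ⟨L, M, hLM, hLM'⟩ := Finset.card_eq_two.mp (show _ = 2 from hP)
  have hL : L ∈ A ∧ P.submodule ≤ L := by
    rw [← Finset.mem_filter, hLM']
    simp
  have hM : M ∈ A ∧ P.submodule ≤ M := by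
    rw [← Finset.mem_filter, hLM']
    simp
  simp only [Set.mem_image, Finset.coe_product]
  refine ⟨(L, M), ⟨hL.1, hM.1⟩, ?_⟩
  symm
  apply Submodule.eq_of_le_of_finrank_le (le_inf hL.2 hM.2)
  have h1 := Submodule.finrank_sup_add_finrank_inf_eq L M
  have h2 : Module.finrank K L < Module.finrank K (L ⊔ M : Submodule K (Fin 3 → K)) := by
    apply Submodule.finrank_lt_finrank_of_lt
    rw [left_lt_sup]
    intro hle
    exact hLM (Submodule.eq_of_le_of_finrank_eq hle (by rw [hA L hL.1, hA M hM.1])).symm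
  rw [hA L hL.1] at h1 h2
  rw [hA M hM.1] at h1
  rw [Projectivization.finrank_submodule]
  omega

theorem card_le_two_mul_ncard_of_frame (A : Arr ℝ) (hA : IsLineArr A) (u w p : Fin 3 → ℝ)
    (hzero : ∀ α β γ : ℝ, α • u + β • w + γ • p = 0 → α = 0 ∧ β = 0 ∧ γ = 0)
    (hspan : ∀ q, ∃ α β γ : ℝ, q = α • u + β • w + γ • p)
    (hw : ∀ L ∈ A, p ∈ L → w ∉ L)
    (hp : 2 ≤ (A.filter fun L => p ∈ L).card)
    (hmod : ∀ q : Fin 3 → ℝ, 2 ≤ (A.filter fun L => q ∈ L).card → q ∉ Submodule.span ℝ {p} →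
      ∃ L ∈ A, p ∈ L ∧ q ∈ L)
    (hne : ∃ L ∈ A, p ∉ L) :
    A.card ≤ 2 * (Sing2Set A).ncard := by
  have hker : ∀ L ∈ A, ∃ φ : (Fin 3 → ℝ) →ₗ[ℝ] ℝ, LinearMap.ker φ = L := fun L hL =>
    exists_ker_eq (by rw [hA L hL, Module.finrank_fin_fun])
  choose! φ hφ using hker
  have hmem : ∀ L ∈ A, ∀ q, q ∈ L ↔ φ L q = 0 := by
    intro L hL q
    conv_lhs => rw [← hφ L hL]
    exact LinearMap.mem_ker
  have hcenter : ∀ L ∈ A, p ∈ L → ∀ α β γ : ℝ, α • u + β • w + γ • p ∈ L ↔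
      β = α * (-φ L u / φ L w) := by
    intro L hL hpL α β γ
    have h1 := (hmem L hL p).mp hpL
    have h2 := (hmem L hL w).not.mp (hw L hL hpL)
    rw [hmem L hL]
    simp only [map_add, map_smul, h1, smul_eq_mul]
    field_simp
    constructor <;> intro h <;> linarith
  have hother : ∀ L ∈ A, p ∉ L → ∀ s v : ℝ, u + s • w + v • p ∈ L ↔
      -φ L u / φ L p + -φ L w / φ L p * s = v := by
    intro L hL hpL s v
    have h1 := (hmem L hL p).not.mp hpL
    rw [hmem L hL]
    simp only [map_add, map_smul, smul_eq_mul]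
    field_simp
    constructor <;> intro h <;> linarith
  have hslope : ∀ L ∈ A, p ∉ L → w + (-φ L w / φ L p) • p ∈ L := by
    intro L hL hpL
    have h1 := (hmem L hL p).not.mp hpL
    rw [hmem L hL]
    simp only [map_add, map_smul, smul_eq_mul]
    field_simp
    ring
  have hspan_p : ∀ α β γ : ℝ, α • u + β • w + γ • p ∈ Submodule.span ℝ {p} → α = 0 ∧ β = 0 := by
    intro α β γ h
    obtain ⟨c, hc⟩ := Submodule.mem_span_singleton.mp h
    have := hzero α β (γ - c) (by rw [sub_smul, hc]; abel)
    exact ⟨this.1, this.2.1⟩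
  set C := A.filter fun L => p ∈ L with hC
  set T := C.image fun L => -φ L u / φ L w with hT
  have hTcard : T.card = C.card := by
    apply Finset.card_image_of_injOn
    intro L hL M hM hLM
    simp only [hC, Finset.coe_filter, Set.mem_ofPred_eq] at hL hM hLM
    ext q
    obtain ⟨α, β, γ, rfl⟩ := hspan q
    rw [hcenter L hL.1 hL.2, hcenter M hM.1 hM.2, hLM]
  obtain ⟨τ, hτ1, hτ2⟩ := exists_interlacing _ (T.orderEmbOfFin rfl).strictMono
  let ι := {L // L ∈ A.filter fun L => p ∉ L}
  let : Fintype ι := Finset.fintypeCoeSort _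
  have hι : ∀ x : ι, x.1 ∈ A ∧ p ∉ x.1 := fun x => Finset.mem_filter.mp x.2
  have hcross : ∀ x y : ι, x ≠ y → ∃ k : Fin T.card,
      -φ x.1 u / φ x.1 p + -φ x.1 w / φ x.1 p * T.orderEmbOfFin rfl k =
      -φ y.1 u / φ y.1 p + -φ y.1 w / φ y.1 p * T.orderEmbOfFin rfl k := by
    intro x y hxy
    obtain ⟨hx, hpx⟩ := hι x
    obtain ⟨hy, hpy⟩ := hι y
    obtain ⟨q, hq0, hqx, hqy⟩ := exists_ne_zero_mem_inf (hA _ hx) (hA _ hy)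
    have hqp : q ∉ Submodule.span ℝ {p} := by
      intro hq
      obtain ⟨c, rfl⟩ := Submodule.mem_span_singleton.mp hq
      have hc : c ≠ 0 := by
        rintro rfl
        simp at hq0
      exact hpx ((Submodule.smul_mem_iff _ hc).mp hqx)
    obtain ⟨L, hL, hpL, hqL⟩ := hmod q
      (two_le_card_filter_mem hx hy (fun h => hxy (Subtype.ext h)) hqx hqy) hqp
    obtain ⟨α, β, γ, rfl⟩ := hspan q
    have hα : α ≠ 0 := by
      rintro rfl
      rw [hcenter L hL hpL, zero_mul] at hqL
      subst hqL
      exact hqp (Submodule.mem_span_singleton.mpr ⟨γ, by simp⟩)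
    rw [hcenter L hL hpL] at hqL
    have hs : -φ L u / φ L w ∈ Set.range (T.orderEmbOfFin rfl) := by
      rw [Finset.range_orderEmbOfFin]
      exact Finset.mem_image_of_mem _ (Finset.mem_filter.mpr ⟨hL, hpL⟩)
    obtain ⟨k, hk⟩ := hs
    have hq : α • u + β • w + γ • p = α • (u + (T.orderEmbOfFin rfl k) • w + (γ / α) • p) := by
      rw [hk, hqL, smul_add, smul_add, smul_smul, smul_smul, mul_div_cancel₀ _ hα]
    rw [hq, Submodule.smul_mem_iff _ hα] at hqx hqy
    exact ⟨k, ((hother _ hx hpx _ _).mp hqx).trans ((hother _ hy hpy _ _).mp hqy).symm⟩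
  let S : LineSweep ι T.card :=
    { a := fun x => -φ x.1 u / φ x.1 p
      b := fun x => -φ x.1 w / φ x.1 p
      t := T.orderEmbOfFin rfl
      τ := τ
      b_injective := by
        intro x y hxy
        by_contra hne
        obtain ⟨hx, hpx⟩ := hι x
        obtain ⟨hy, hpy⟩ := hι y
        have h1 := hslope _ hx hpx
        have h2 := hslope _ hy hpy
        rw [← show -φ x.1 w / φ x.1 p = -φ y.1 w / φ y.1 p from hxy] at h2
        generalize -φ x.1 w / φ x.1 p = v at h1 h2
        have hv : w + v • p = (0 : ℝ) • u + (1 : ℝ) • w + v • p := by simp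
        obtain ⟨L, hL, hpL, hqL⟩ := hmod _
          (two_le_card_filter_mem hx hy (fun h => hne (Subtype.ext h)) h1 h2) (by
            rw [hv]
            intro h
            simpa using (hspan_p _ _ _ h).2)
        rw [hv, hcenter L hL hpL] at hqL
        simp at hqL
      t_injective := (T.orderEmbOfFin rfl).injective
      exists_cross := hcross
      t_lt_τ := hτ1
      τ_lt_t := hτ2 }
  have : Nonempty ι := by
    obtain ⟨L, hL, hpL⟩ := hne
    exact ⟨⟨L, by simp [hL, hpL]⟩⟩
  have hmain := S.le_two_mul_card_simplePts (by rw [hTcard]; exact hp)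
  have hcard : A.card = T.card + Fintype.card ι := by
    rw [hTcard, Fintype.card_coe]
    exact (Finset.card_filter_add_card_filter_not _).symm
  have hpt : ∀ q : Fin T.card × ℝ, u + (S.t q.1) • w + q.2 • p ≠ 0 := by
    intro q hq
    have := (hzero 1 (S.t q.1) q.2 (by rwa [one_smul])).1
    simp at this
  have hle : S.simplePts.card ≤ (Sing2Set A).ncard := by
    rw [← Set.ncard_coe_finset]
    refine Set.ncard_le_ncard_of_injOn
      (fun q => Projectivization.mk ℝ (u + (S.t q.1) • w + q.2 • p) (hpt q)) ?_ ?_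
      (finite_sing2Set hA)
    · intro q hq
      have hq1 : (S.block q).card = 1 := (Finset.mem_filter.mp hq).2
      show multAt A _ = 2
      rw [multAt_mk, ← Finset.card_filter_add_card_filter_not fun L => p ∈ L,
        Finset.filter_filter, Finset.filter_filter]
      have h1 : (A.filter fun L => u + (S.t q.1) • w + q.2 • p ∈ L ∧ p ∈ L).card = 1 := by
        have hs : S.t q.1 ∈ T := T.orderEmbOfFin_mem rfl q.1
        obtain ⟨L, hL, hLs⟩ := Finset.mem_image.mp hs
        have hL' := Finset.mem_filter.mp hL
        have hinj := Finset.card_image_iff.mp hTcard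
        rw [Finset.card_eq_one]
        refine ⟨L, ?_⟩
        ext M
        simp only [Finset.mem_filter, Finset.mem_singleton]
        have key : ∀ M ∈ A, p ∈ M → (u + (S.t q.1) • w + q.2 • p ∈ M ↔
            S.t q.1 = -φ M u / φ M w) := by
          intro M hM hpM
          have := hcenter M hM hpM 1 (S.t q.1) q.2
          rwa [one_smul, one_mul] at this
        constructor
        · rintro ⟨hM, hqM, hpM⟩
          apply hinj (Finset.mem_filter.mpr ⟨hM, hpM⟩) hL
          rw [key M hM hpM] at hqM
          exact hqM.symm.trans hLs.symm
        · rintro rfl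
          exact ⟨hL'.1, (key _ hL'.1 hL'.2).mpr hLs.symm, hL'.2⟩
      have h2 : (A.filter fun L => u + (S.t q.1) • w + q.2 • p ∈ L ∧ p ∉ L).card =
          (S.block q).card := by
        symm
        refine Finset.card_bij (fun x _ => x.1) ?_ ?_ ?_
        · intro x hx
          obtain ⟨hxA, hpx⟩ := hι x
          rw [S.mem_block] at hx
          exact Finset.mem_filter.mpr ⟨hxA, (hother _ hxA hpx _ _).mpr hx, hpx⟩
        · intro x _ y _ h
          exact Subtype.ext h
        · intro L hL
          obtain ⟨hLA, hqL, hpL⟩ := Finset.mem_filter.mp hL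
          refine ⟨⟨L, Finset.mem_filter.mpr ⟨hLA, hpL⟩⟩, ?_, rfl⟩
          rw [S.mem_block]
          exact (hother _ hLA hpL _ _).mp hqL
      rw [h1, h2, hq1]
    · intro q _ q' _ h
      obtain ⟨c, hc⟩ := (Projectivization.mk_eq_mk_iff' _ _ _ _ _).mp h
      obtain ⟨h1, h2, h3⟩ := hzero (c - 1) (c * S.t q'.1 - S.t q.1) (c * q'.2 - q.2) (by
        have := sub_eq_zero.mpr hc
        rw [← this]
        module)
      have hc1 : c = 1 := by linarith
      subst hc1
      rw [one_mul] at h2 h3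
      refine Prod.ext (S.t_injective ?_) ?_ <;> linarith
  omega

/-- Dirac–Motzkin for real supersolvable arrangements:
`|Sing₂(A)| ≥ |A| / 2`. -/
theorem dirac_motzkin_supersolvable_real (A : Arr ℝ) (hA : IsLineArr A)
    (hfr : FullRank A) (hss : Supersolvable A) :
    A.card ≤ 2 * (Sing2Set A).ncard := by
  obtain ⟨P, hP, hmod⟩ := hss
  induction P using Projectivization.ind with
  | h p hp0 =>
  have hP' : 2 ≤ (A.filter fun L => p ∈ L).card := by
    rw [← multAt_mk A p hp0]
    exact hP
  obtain ⟨w, hw⟩ : ∃ w, ∀ L ∈ A, w ∉ L := by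
    have h := Subspace.biUnion_ne_univ_of_top_notMem (s := A) (k := ℝ) (E := Fin 3 → ℝ) (by
      intro h
      have := hA _ h
      rw [finrank_top, Module.finrank_fin_fun] at this
      omega)
    rw [Set.ne_univ_iff_exists_notMem] at h
    obtain ⟨w, hw⟩ := h
    refine ⟨w, fun L hL hwL => hw ?_⟩
    simp only [Set.mem_iUnion]
    exact ⟨L, hL, hwL⟩
  obtain ⟨L₀, hL₀⟩ : ∃ L, L ∈ A.filter fun L => p ∈ L := by
    apply Finset.card_pos.mp
    omega
  obtain ⟨hL₀A, hpL₀⟩ := Finset.mem_filter.mp hL₀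
  have hwp : LinearIndependent ℝ ![w, p] := by
    rw [LinearIndependent.pair_symm_iff, LinearIndependent.pair_iff' hp0]
    intro c hc
    exact hw L₀ hL₀A (hc ▸ L₀.smul_mem c hpL₀)
  obtain ⟨u, hu⟩ : ∃ u, u ∉ Submodule.span ℝ (Set.range ![w, p]) := by
    by_contra! h
    have h1 := finrank_span_eq_card hwp
    rw [Submodule.eq_top_iff'.mpr h, finrank_top, Module.finrank_fin_fun] at h1
    simp at h1
  have hind : LinearIndependent ℝ ![u, w, p] := linearIndependent_finCons.mpr ⟨hwp, hu⟩
  apply card_le_two_mul_ncard_of_frame A hA u w p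
  · intro α β γ h
    have := Fintype.linearIndependent_iff.mp hind ![α, β, γ] (by simpa [Fin.sum_univ_three] using h)
    exact ⟨this 0, this 1, this 2⟩
  · intro q
    have hq : q ∈ Submodule.span ℝ (Set.range ![u, w, p]) := by
      rw [hind.span_eq_top_of_card_eq_finrank (by simp)]
      trivial
    obtain ⟨c, hc⟩ := (Submodule.mem_span_range_iff_exists_fun ℝ).mp hq
    exact ⟨c 0, c 1, c 2, by rw [← hc]; simp [Fin.sum_univ_three]⟩
  · exact fun L hL _ => hw L hL
  · exact hP'
  · intro q hq hqp
    have hq0 : q ≠ 0 := by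
      rintro rfl
      exact hqp (Submodule.zero_mem _)
    have h := hmod (Projectivization.mk ℝ q hq0) (by
      show 2 ≤ multAt A _
      rwa [multAt_mk]) (by
      intro h
      obtain ⟨c, hc⟩ := (Projectivization.mk_eq_mk_iff' _ _ _ _ _).mp h
      exact hqp (Submodule.mem_span_singleton.mpr ⟨c, hc⟩))
    rw [Projectivization.submodule_mk, Projectivization.submodule_mk] at h
    exact ⟨_, h, Submodule.mem_sup_left (Submodule.mem_span_singleton_self p),
      Submodule.mem_sup_right (Submodule.mem_span_singleton_self q)⟩
  · by_contra! h
    apply hp0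
    have : p ∈ (⨅ L ∈ A, L) := by
      simp only [Submodule.mem_iInf]
      exact h
    rw [hfr] at this
    exact this
end

section
/- Let m ≥ 3 and let 𝒜_{2m} be the Böröczky arrangement of 2m lines in ℙ²(ℝ): the lines L_j defined by cos(2πj/m)·x + sin(2πj/m)·y + z = 0 for 0 ≤ j ≤ m−1, together with the lines L′_k defined by sin(πk/m)·x − cos(πk/m)·y = 0 for 0 ≤ k ≤ m−1. Then the point P = [0:0:1] lies on all the lines L′_k, is a modular point of 𝒜_{2m} of maximum multiplicity m(𝒜_{2m}) = m, and 𝒜_{2m} is supersolvable. -/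
open scoped Classical

/-- The projective line in `ℙ²(ℝ)` with equation `a·x + b·y + c·z = 0`. -/
noncomputable def lineOf (a b c : ℝ) : Submodule ℝ (Fin 3 → ℝ) :=
  LinearMap.ker
    ((a • LinearMap.proj 0 + b • LinearMap.proj 1 + c • LinearMap.proj 2 :
      (Fin 3 → ℝ) →ₗ[ℝ] ℝ))

/-- The line `L_j : cos(2πj/m)·x + sin(2πj/m)·y + z = 0`. -/
noncomputable def lineL (m j : ℕ) : Submodule ℝ (Fin 3 → ℝ) :=
  lineOf (Real.cos (2 * Real.pi * j / m)) (Real.sin (2 * Real.pi * j / m)) 1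

/-- The line `L'_k : sin(πk/m)·x − cos(πk/m)·y = 0`. -/
noncomputable def lineL' (m k : ℕ) : Submodule ℝ (Fin 3 → ℝ) :=
  lineOf (Real.sin (Real.pi * k / m)) (-Real.cos (Real.pi * k / m)) 0

/-- The Böröczky arrangement `𝒜_{2m}` of `2m` lines. -/
noncomputable def boro (m : ℕ) : Arr ℝ :=
  ((Finset.range m).image fun j => lineL m j) ∪ ((Finset.range m).image fun k => lineL' m k)

/-- The point `P = [0:0:1]`. -/
noncomputable def boroP : Pt ℝ :=
  Projectivization.mk ℝ ![0, 0, 1] (fun h => by simpa using congrFun h 2)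

theorem mem_lineOf {a b c : ℝ} {v : Fin 3 → ℝ} :
    v ∈ lineOf a b c ↔ a * v 0 + b * v 1 + c * v 2 = 0 := by
  simp [lineOf]

theorem mem_lineL {m j : ℕ} {v : Fin 3 → ℝ} :
    v ∈ lineL m j ↔
      Real.cos (2 * Real.pi * j / m) * v 0 + Real.sin (2 * Real.pi * j / m) * v 1 + v 2 = 0 := by
  rw [lineL, mem_lineOf, one_mul]

theorem mem_lineL' {m k : ℕ} {v : Fin 3 → ℝ} :
    v ∈ lineL' m k ↔ Real.sin (Real.pi * k / m) * v 0 = Real.cos (Real.pi * k / m) * v 1 := by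
  rw [lineL', mem_lineOf]
  constructor <;> intro h <;> linarith

theorem mk_submodule_le_iff {v : Fin 3 → ℝ} (hv : v ≠ 0) (L : Submodule ℝ (Fin 3 → ℝ)) :
    (Projectivization.mk ℝ v hv).submodule ≤ L ↔ v ∈ L := by
  rw [Projectivization.submodule_mk, Submodule.span_singleton_le_iff_mem]

theorem boroP_le_lineL' (m k : ℕ) : boroP.submodule ≤ lineL' m k := by
  rw [boroP, mk_submodule_le_iff, mem_lineL']
  simp

theorem not_boroP_le_lineL (m j : ℕ) : ¬ boroP.submodule ≤ lineL m j := by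
  rw [boroP, mk_submodule_le_iff, mem_lineL]
  simp

theorem mk_eq_boroP {v : Fin 3 → ℝ} (hv : v ≠ 0) (h0 : v 0 = 0) (h1 : v 1 = 0) :
    Projectivization.mk ℝ v hv = boroP := by
  rw [boroP, Projectivization.mk_eq_mk_iff']
  refine ⟨v 2, ?_⟩
  ext i
  fin_cases i <;> simp [h0, h1]

/-- Two distinct lines through the origin of the plane meet only at the origin. -/
theorem eq_zero_of_sin_mul_eq_cos_mul {a b x y : ℝ} (hab : Real.sin (a - b) ≠ 0)
    (ha : Real.sin a * x = Real.cos a * y) (hb : Real.sin b * x = Real.cos b * y) :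
    x = 0 ∧ y = 0 := by
  rw [Real.sin_sub] at hab
  constructor <;> refine (mul_eq_zero.1 ?_).resolve_left hab
  · linear_combination Real.cos b * ha - Real.cos a * hb
  · linear_combination Real.sin b * ha - Real.sin a * hb

theorem sin_pi_mul_sub_ne_zero {m i j : ℕ} (hi : i < m) (hj : j < m) (hij : i ≠ j) :
    Real.sin (Real.pi * ((i : ℝ) - j) / m) ≠ 0 := by
  have hm : (0 : ℝ) < m := by exact_mod_cast (by omega : 0 < m)
  intro h
  obtain ⟨n, hn⟩ := Real.sin_eq_zero_iff.1 h
  rw [eq_div_iff hm.ne'] at hn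
  have h1 : (n : ℝ) * m = (i : ℝ) - j :=
    mul_left_cancel₀ Real.pi_ne_zero (by linear_combination hn)
  have h2 : n * (m : ℤ) = (i : ℤ) - j := by exact_mod_cast h1
  have h3 : (i : ℤ) - j = 0 := by
    refine Int.eq_zero_of_abs_lt_dvd (m := m) ⟨n, by linarith⟩ ?_
    rw [abs_lt]
    constructor <;> omega
  omega

/-- The intersection point of `L_i` and `L_j` lies on the line through the origin at angle
`π(i + j)/m`. -/
theorem sin_mul_eq_cos_mul_of_mem_lineL {m i j : ℕ} (hi : i < m) (hj : j < m) (hij : i ≠ j)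
    {v : Fin 3 → ℝ} (hvi : v ∈ lineL m i) (hvj : v ∈ lineL m j) :
    Real.sin (Real.pi * (i + j : ℕ) / m) * v 0 = Real.cos (Real.pi * (i + j : ℕ) / m) * v 1 := by
  have hd := sin_pi_mul_sub_ne_zero hi hj hij
  rw [mem_lineL] at hvi hvj
  have ei : 2 * Real.pi * i / m =
      Real.pi * (i + j : ℕ) / m + Real.pi * ((i : ℝ) - j) / m := by
    push_cast; ring
  have ej : 2 * Real.pi * j / m =
      Real.pi * (i + j : ℕ) / m - Real.pi * ((i : ℝ) - j) / m := by
    push_cast; ring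
  rw [ei, Real.cos_add, Real.sin_add] at hvi
  rw [ej, Real.cos_sub, Real.sin_sub] at hvj
  refine mul_left_cancel₀ hd ?_
  linear_combination (hvj - hvi) / 2

theorem lineL'_add_self {m : ℕ} (hm : 0 < m) (k : ℕ) : lineL' m (k + m) = lineL' m k := by
  have hm' : (m : ℝ) ≠ 0 := by exact_mod_cast hm.ne'
  have e : Real.pi * (k + m : ℕ) / m = Real.pi * k / m + Real.pi := by
    push_cast; field_simp
  ext v
  rw [mem_lineL', mem_lineL', e, Real.sin_add_pi, Real.cos_add_pi, neg_mul, neg_mul, neg_inj]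

theorem exists_mem_lineL'_of_mem_lineL {m i j : ℕ} (hi : i < m) (hj : j < m) (hij : i ≠ j)
    {v : Fin 3 → ℝ} (hvi : v ∈ lineL m i) (hvj : v ∈ lineL m j) :
    ∃ k < m, v ∈ lineL' m k := by
  have h := mem_lineL'.2 (sin_mul_eq_cos_mul_of_mem_lineL hi hj hij hvi hvj)
  rcases lt_or_ge (i + j) m with hlt | hge
  · exact ⟨i + j, hlt, h⟩
  · refine ⟨i + j - m, by omega, ?_⟩
    rwa [← lineL'_add_self (by omega), Nat.sub_add_cancel hge]

theorem eq_zero_of_mem_lineL' {m i j : ℕ} (hi : i < m) (hj : j < m) (hij : i ≠ j)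
    {v : Fin 3 → ℝ} (hvi : v ∈ lineL' m i) (hvj : v ∈ lineL' m j) : v 0 = 0 ∧ v 1 = 0 := by
  refine eq_zero_of_sin_mul_eq_cos_mul ?_ (mem_lineL'.1 hvi) (mem_lineL'.1 hvj)
  have := sin_pi_mul_sub_ne_zero hi hj hij
  rwa [mul_sub, sub_div] at this

theorem lineL'_injOn (m : ℕ) : Set.InjOn (lineL' m) (Finset.range m) := by
  intro i hi j hj h
  by_contra hij
  have hv : ![Real.cos (Real.pi * i / m), Real.sin (Real.pi * i / m), 0] ∈ lineL' m i := by
    rw [mem_lineL']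
    simp [mul_comm]
  have h0 := eq_zero_of_mem_lineL' (by simpa using hi) (by simpa using hj) hij hv (h ▸ hv)
  have h1 := Real.sin_sq_add_cos_sq (Real.pi * i / m)
  simp_all

theorem mem_boro {m : ℕ} {L : Submodule ℝ (Fin 3 → ℝ)} :
    L ∈ boro m ↔ (∃ j < m, lineL m j = L) ∨ ∃ k < m, lineL' m k = L := by
  simp [boro]

theorem multAt_boro_boroP (m : ℕ) : multAt (boro m) boroP = m := by
  have : (boro m).filter (fun L => boroP.submodule ≤ L) = (Finset.range m).image (lineL' m) := by
    ext L
    rw [Finset.mem_filter, mem_boro]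
    simp only [Finset.mem_image, Finset.mem_range]
    constructor
    · rintro ⟨⟨j, -, rfl⟩ | h, hL⟩
      · exact absurd hL (not_boroP_le_lineL m j)
      · exact h
    · rintro ⟨k, hk, rfl⟩
      exact ⟨Or.inr ⟨k, hk, rfl⟩, boroP_le_lineL' m k⟩
  rw [multAt, this, Finset.card_image_of_injOn (lineL'_injOn m), Finset.card_range]

/-- The line joining `[0:0:1]` to another point of `L'_k` is `L'_k`. -/
theorem boroP_sup_eq_lineL' {m k : ℕ} {v : Fin 3 → ℝ} (hv : v ≠ 0)
    (hP : Projectivization.mk ℝ v hv ≠ boroP) (hk : v ∈ lineL' m k) :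
    boroP.submodule ⊔ (Projectivization.mk ℝ v hv).submodule = lineL' m k := by
  refine le_antisymm (sup_le (boroP_le_lineL' m k) ((mk_submodule_le_iff hv _).2 hk)) ?_
  intro w hw
  rw [mem_lineL'] at hk hw
  set c := Real.cos (Real.pi * k / m)
  set s := Real.sin (Real.pi * k / m)
  have hcs : s ^ 2 + c ^ 2 = 1 := Real.sin_sq_add_cos_sq _
  have v0 : v 0 = (c * v 0 + s * v 1) * c := by linear_combination s * hk - v 0 * hcs
  have v1 : v 1 = (c * v 0 + s * v 1) * s := by linear_combination -c * hk - v 1 * hcs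
  have w0 : w 0 = (c * w 0 + s * w 1) * c := by linear_combination s * hw - w 0 * hcs
  have w1 : w 1 = (c * w 0 + s * w 1) * s := by linear_combination -c * hw - w 1 * hcs
  have hr : c * v 0 + s * v 1 ≠ 0 := by
    intro h
    rw [h, zero_mul] at v0 v1
    exact hP (mk_eq_boroP hv v0 v1)
  generalize c * v 0 + s * v 1 = r at *
  generalize c * w 0 + s * w 1 = t at *
  rw [boroP, Projectivization.submodule_mk, Projectivization.submodule_mk, Submodule.mem_sup]
  refine ⟨(w 2 - t / r * v 2) • ![0, 0, 1], Submodule.smul_mem _ _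
    (Submodule.mem_span_singleton_self _), (t / r) • v, Submodule.smul_mem _ _
    (Submodule.mem_span_singleton_self _), ?_⟩
  ext i
  fin_cases i
  · simp [v0, w0]; field_simp
  · simp [v1, w1]; field_simp
  · simp

theorem isModular_boro_boroP {m : ℕ} (hm : 2 ≤ m) : IsModular (boro m) boroP := by
  refine ⟨by rwa [SingSet, Set.mem_ofPred_eq, multAt_boro_boroP], fun Q hQ hne => ?_⟩
  induction Q using Projectivization.ind with
  | h v hv =>
    suffices h : ∃ k < m, v ∈ lineL' m k by
      obtain ⟨k, hk, hvk⟩ := h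
      rw [boroP_sup_eq_lineL' hv hne hvk]
      exact mem_boro.2 (Or.inr ⟨k, hk, rfl⟩)
    obtain ⟨L, hL, M, hM, hLM⟩ := Finset.one_lt_card.1 hQ
    rw [Finset.mem_filter, mk_submodule_le_iff, mem_boro] at hL hM
    obtain ⟨⟨i, hi, rfl⟩ | ⟨k, hk, rfl⟩, hvL⟩ := hL
    · obtain ⟨⟨j, hj, rfl⟩ | ⟨k, hk, rfl⟩, hvM⟩ := hM
      · exact exists_mem_lineL'_of_mem_lineL hi hj (fun h => hLM (h ▸ rfl)) hvL hvM
      · exact ⟨k, hk, hvM⟩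
    · exact ⟨k, hk, hvL⟩

/-- Away from `[0:0:1]`, a point lies on at most two lines `L_j` and at most one line `L'_k`. -/
theorem multAt_boro_le_three (m : ℕ) {Q : Pt ℝ} (hQ : Q ≠ boroP) : multAt (boro m) Q ≤ 3 := by
  induction Q using Projectivization.ind with
  | h v hv =>
    rw [multAt, boro, Finset.filter_union]
    refine (Finset.card_union_le _ _).trans (Nat.add_le_add (b := 2) (d := 1) ?_ ?_)
    · by_contra! h
      obtain ⟨A, hA, B, hB, C, hC, hAB, hAC, hBC⟩ := Finset.two_lt_card.1 h
      simp only [Finset.mem_filter, mk_submodule_le_iff, Finset.mem_image, Finset.mem_range]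
        at hA hB hC
      obtain ⟨⟨i, hi, rfl⟩, hvi⟩ := hA
      obtain ⟨⟨j, hj, rfl⟩, hvj⟩ := hB
      obtain ⟨⟨k, hk, rfl⟩, hvk⟩ := hC
      have hij := sin_mul_eq_cos_mul_of_mem_lineL hi hj (fun h => hAB (h ▸ rfl)) hvi hvj
      have hik := sin_mul_eq_cos_mul_of_mem_lineL hi hk (fun h => hAC (h ▸ rfl)) hvi hvk
      have hjk := sin_pi_mul_sub_ne_zero hj hk (fun h => hBC (h ▸ rfl))
      have e : Real.pi * ((j : ℝ) - k) / m =
          Real.pi * (i + j : ℕ) / m - Real.pi * (i + k : ℕ) / m := by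
        push_cast; ring
      rw [e] at hjk
      obtain ⟨h0, h1⟩ := eq_zero_of_sin_mul_eq_cos_mul hjk hij hik
      exact hQ (mk_eq_boroP hv h0 h1)
    · rw [Finset.card_le_one]
      intro A hA B hB
      simp only [Finset.mem_filter, mk_submodule_le_iff, Finset.mem_image, Finset.mem_range]
        at hA hB
      obtain ⟨⟨i, hi, rfl⟩, hvi⟩ := hA
      obtain ⟨⟨j, hj, rfl⟩, hvj⟩ := hB
      by_contra hne
      obtain ⟨h0, h1⟩ := eq_zero_of_mem_lineL' hi hj (fun h => hne (h ▸ rfl)) hvi hvj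
      exact hQ (mk_eq_boroP hv h0 h1)

theorem maxMult_boro {m : ℕ} (hm : 3 ≤ m) : maxMult (boro m) = m := by
  refine IsGreatest.csSup_eq ⟨⟨boroP, (isModular_boro_boroP (by omega)).1, multAt_boro_boroP m⟩, ?_⟩
  rintro _ ⟨Q, -, rfl⟩
  by_cases hQ : Q = boroP
  · rw [hQ, multAt_boro_boroP]
  · exact (multAt_boro_le_three m hQ).trans hm

/-- For `m ≥ 3`, the point `P = [0:0:1]` lies on all the lines `L'_k`, is a
modular point of the Böröczky arrangement `𝒜_{2m}` of maximum multiplicity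
`m(𝒜_{2m}) = m`, and `𝒜_{2m}` is supersolvable. -/
theorem boroczky_supersolvable (m : ℕ) (hm : 3 ≤ m) :
    (∀ k < m, boroP.submodule ≤ lineL' m k) ∧
    IsModular (boro m) boroP ∧
    multAt (boro m) boroP = m ∧
    maxMult (boro m) = m ∧
    Supersolvable (boro m) := by
  have hmod := isModular_boro_boroP (m := m) (by omega)
  exact ⟨fun k _ => boroP_le_lineL' m k, hmod, multAt_boro_boroP m, maxMult_boro hm, boroP, hmod⟩
end
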